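/- Let C be the reduced bar complex of the lower-indexed Behrens algebra R: the chain complex of F_2-vector spaces with C_0 = F_2, C_r = the r-fold tensor power (over F_2) of the augmentation ideal I of R for r >= 1, and differential d : C_r -> C_{r-1} given by d(x_1 tensor ... tensor x_r) = SUM_{i=1}^{r-1} x_1 tensor ... tensor (x_i x_{i+1}) tensor ... tensor x_r (signs are irrelevant mod 2, and the outer face maps vanish since the coefficients are the trivial module F_2). Grade I by monomial length using the length grading of R, and grade each C_r by total length. Then for each w >= 0 the total-length-w homogeneous part C^{(w)} is a subcomplex, C is the direct sum of the subcomplexes C^{(w)}, and the r-th homology of C^{(w)} vanishes whenever w is not equal to r. In other words, the Behrens algebra R is a Koszul algebra: its Tor groups Tor_r(F_2, F_2) are concentrated in length weight r. -/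

import Mathlib

/-!
STATEMENT 7: Koszulity of the lower-indexed Behrens algebra, via its reduced bar
complex. We define `C 0 = F₂`, `C r = I^{⊗r}` (tensor powers over `F₂` of the
augmentation ideal `I`, built as iterated binary tensor products), with the bar
differential `d(x₁ ⊗ ⋯ ⊗ x_r) = ∑_{i=1}^{r-1} x₁ ⊗ ⋯ ⊗ (xᵢ xᵢ₊₁) ⊗ ⋯ ⊗ x_r`
(signs irrelevant mod 2; outer faces vanish for trivial coefficients `F₂`).
Grading `I` by monomial length via the length grading of the Behrens algebra and
each `C r` by total length, the theorem asserts: each total-length-`w` part is a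
subcomplex, `C` is the direct sum of these subcomplexes, and the `r`-th homology
of the weight-`w` subcomplex vanishes whenever `w ≠ r`. That is, the Behrens
algebra is Koszul: `Tor_r(F₂, F₂)` is concentrated in length weight `r`.
-/

noncomputable section
open scoped BigOperators TensorProduct

def Q (a : ℕ) : FreeAlgebra (ZMod 2) ℕ := FreeAlgebra.ι (ZMod 2) a

def behrensCoeff (a b c : ℕ) : ZMod 2 :=
  if c ≤ b ∧ 2 * c + 2 ≤ a + b then ((a + b - 2 * c - 2).choose (b - c) : ZMod 2) else 0

def behrensRHS (a b : ℕ) : FreeAlgebra (ZMod 2) ℕ :=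
  ∑ c ∈ Finset.range (a + 2 * b),
    if 3 * c + 1 < a + 2 * b then behrensCoeff a b c • (Q (a + 2 * b - 2 * c) * Q c) else 0

inductive BehrensRel : FreeAlgebra (ZMod 2) ℕ → FreeAlgebra (ZMod 2) ℕ → Prop
  | mk (a b : ℕ) (h : a ≤ b + 1) : BehrensRel (Q a * Q b) (behrensRHS a b)

abbrev BehrensAlgebra : Type := RingQuot BehrensRel

def toBehrens : FreeAlgebra (ZMod 2) ℕ →ₐ[ZMod 2] BehrensAlgebra :=
  RingQuot.mkAlgHom (ZMod 2) BehrensRel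

def mon (L : List ℕ) : FreeAlgebra (ZMod 2) ℕ := (L.map Q).prod

/-- The augmentation of the Behrens algebra, sending every generator `Q a` to `0`. -/
def aug : BehrensAlgebra →ₐ[ZMod 2] ZMod 2 :=
  RingQuot.liftAlgHom (ZMod 2)
    ⟨FreeAlgebra.lift (ZMod 2) (fun _ => (0 : ZMod 2)), by
      intro x y h
      cases h with
      | mk a b hab =>
        trans (0 : ZMod 2)
        · simp [Q]
        · rw [behrensRHS, map_sum]
          symm
          apply Finset.sum_eq_zero
          intro c _
          split
          · rw [map_smul, map_mul]
            simp [Q]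
          · simp⟩

/-- The augmentation ideal of the Behrens algebra, as an `F₂`-subspace. -/
def augIdeal : Submodule (ZMod 2) BehrensAlgebra := LinearMap.ker aug.toLinearMap

/-- Multiplication on the augmentation ideal, as an `F₂`-bilinear map. -/
def mulI : ↥augIdeal →ₗ[ZMod 2] ↥augIdeal →ₗ[ZMod 2] ↥augIdeal :=
  LinearMap.mk₂ (ZMod 2)
    (fun x y => ⟨(x : BehrensAlgebra) * (y : BehrensAlgebra), by
      have hx : aug (x : BehrensAlgebra) = 0 := x.2
      show aug.toLinearMap _ = 0
      simp [map_mul, hx]⟩)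
    (fun x x' y => Subtype.ext (by simp [add_mul]))
    (fun c x y => Subtype.ext (by simp [smul_mul_assoc]))
    (fun x y y' => Subtype.ext (by simp [mul_add]))
    (fun c x y => Subtype.ext (by simp [mul_smul_comm]))

/-- Multiplication `I ⊗ I → I` as a linear map. -/
def mulMap : (↥augIdeal ⊗[ZMod 2] ↥augIdeal) →ₗ[ZMod 2] ↥augIdeal :=
  TensorProduct.lift mulI

/-- The terms of the reduced bar complex: `C 0 = F₂` and `C (r+1) = I ⊗ C r`,
the `r`-fold tensor power (over `F₂`) of the augmentation ideal. -/
def C : ℕ → ModuleCat (ZMod 2)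
  | 0 => ModuleCat.of (ZMod 2) (ZMod 2)
  | (r + 1) => ModuleCat.of (ZMod 2) (↥augIdeal ⊗[ZMod 2] (C r))

/-- The bar differential `d : C (r+1) → C r`, given on elementary tensors by
`d(x₁ ⊗ ⋯ ⊗ x_{r+1}) = ∑_{i=1}^{r} x₁ ⊗ ⋯ ⊗ (xᵢ * xᵢ₊₁) ⊗ ⋯ ⊗ x_{r+1}`
(the outer face maps vanish since the coefficients form the trivial module `F₂`;
signs are irrelevant mod 2). -/
def dBar : (r : ℕ) → ((C (r + 1)) →ₗ[ZMod 2] (C r))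
  | 0 => 0
  | (r + 1) =>
      ((LinearMap.lTensor ↥augIdeal (dBar r) :
          (↥augIdeal ⊗[ZMod 2] (↥augIdeal ⊗[ZMod 2] (C r))) →ₗ[ZMod 2]
            (↥augIdeal ⊗[ZMod 2] (C r))) +
        ((LinearMap.rTensor (C r) mulMap).comp
            (TensorProduct.assoc (ZMod 2) ↥augIdeal ↥augIdeal (C r)).symm.toLinearMap :
          (↥augIdeal ⊗[ZMod 2] (↥augIdeal ⊗[ZMod 2] (C r))) →ₗ[ZMod 2]
            (↥augIdeal ⊗[ZMod 2] (C r))) :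
        (C (r + 2)) →ₗ[ZMod 2] (C (r + 1)))

/-- The length grading of the Behrens algebra: `Rdeg m` is the `F₂`-span of the images
of the length-`m` monomials (this is a genuine grading since the relation ideal is
homogeneous quadratic). -/
def Rdeg (m : ℕ) : Submodule (ZMod 2) BehrensAlgebra :=
  Submodule.span (ZMod 2)
    {x : BehrensAlgebra | ∃ L : List ℕ, L.length = m ∧ x = toBehrens (mon L)}

/-- The total-length-`w` homogeneous part `C^{(w)}_r` of the bar complex: it is spanned
by the elementary tensors of homogeneous elements of the augmentation ideal whose
lengths sum to `w`. -/
def Wt : (r : ℕ) → ℕ → Submodule (ZMod 2) (C r)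
  | 0, w => if w = 0 then ⊤ else ⊥
  | (r + 1), w =>
      Submodule.span (ZMod 2)
        {z : ↥augIdeal ⊗[ZMod 2] (C r) | ∃ (m m' : ℕ) (x : ↥augIdeal) (y : C r),
          m + m' = w ∧ ((x : BehrensAlgebra) ∈ Rdeg m) ∧ y ∈ Wt r m' ∧
          z = x ⊗ₜ[ZMod 2] y}

/-! ### A binomial identity modulo 2 -/

/-- The generalized binomial coefficient with an integral upper entry, reduced modulo 2. -/
def bin (n : ℤ) (k : ℕ) : ZMod 2 := ((Ring.choose n k : ℤ) : ZMod 2)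

lemma bin_zero (n : ℤ) : bin n 0 = 1 := by simp [bin]

lemma bin_one (n : ℤ) : bin n 1 = n := by simp [bin]

lemma bin_natCast (n k : ℕ) : bin n k = (n.choose k : ZMod 2) := by
  simp [bin, Ring.choose_natCast]

lemma bin_succ_succ (n : ℤ) (k : ℕ) : bin (n + 1) (k + 1) = bin n k + bin n (k + 1) := by
  simp [bin, Ring.choose_succ_succ]

/-- The coefficient of `t ^ M` in `(1 + t) ^ (N - 2 * i) * (1 + t + t ^ 2) ^ i` modulo 2. -/
def binConv (i : ℕ) (N : ℤ) (M : ℕ) : ZMod 2 :=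
  ∑ c ∈ Finset.range (M + 1), (i.choose c : ZMod 2) * bin (N - 2 * c) (M - c)

lemma binConv_succ_upper (i : ℕ) (N : ℤ) (M : ℕ) :
    binConv i (N + 1) (M + 1) = binConv i N (M + 1) + binConv i N M := by
  unfold binConv
  rw [Finset.sum_range_succ, Finset.sum_range_succ _ (M + 1), add_right_comm,
    ← Finset.sum_add_distrib]
  congr 1
  · refine Finset.sum_congr rfl fun c hc => ?_
    have hc' : c ≤ M := by simpa [Nat.lt_succ_iff] using hc
    have h1 : M + 1 - c = (M - c) + 1 := by omega
    have h2 : N + 1 - 2 * (c : ℤ) = (N - 2 * c) + 1 := by ring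
    rw [h1, h2, bin_succ_succ]
    ring
  · simp [bin_zero]

lemma binConv_succ_left (i : ℕ) (N : ℤ) (M : ℕ) :
    binConv (i + 1) N (M + 1) = binConv i N (M + 1) + binConv i (N - 2) M := by
  unfold binConv
  rw [Finset.sum_range_succ', Finset.sum_range_succ' _ (M + 1), add_right_comm,
    ← Finset.sum_add_distrib]
  congr 1
  · refine Finset.sum_congr rfl fun c _ => ?_
    have h1 : M + 1 - (c + 1) = M - c := by omega
    have h2 : N - 2 * ((c + 1 : ℕ) : ℤ) = N - 2 - 2 * c := by push_cast; ring
    rw [h1, h2, Nat.choose_succ_succ]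
    push_cast
    ring
  · simp

lemma zmod_two_add_self (x : ZMod 2) : x + x = 0 := CharTwo.add_self_eq_zero x

lemma binConv_eq_choose (i : ℕ) : ∀ (α e : ℕ), e ≤ 1 →
    binConv i (i + α + e) (2 * α + e) = (i.choose α : ZMod 2) := by
  induction i with
  | zero =>
    intro α e he
    have h : binConv 0 ((0 : ℕ) + α + e) (2 * α + e) = ((α + e).choose (2 * α + e) : ZMod 2) := by
      unfold binConv
      rw [Finset.sum_range_succ', Finset.sum_eq_zero (fun c _ => by simp)]
      simp [← bin_natCast]
    rw [h]
    rcases α with _ | α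
    · simp
    · rw [Nat.choose_eq_zero_of_lt (by omega)]
      simp
  | succ i ih =>
    intro α e he
    rcases α with _ | α
    · interval_cases e
      · simp [binConv, bin_zero]
      · simp only [binConv, Finset.sum_range_succ, Finset.sum_range_zero]
        simp only [bin_zero, Nat.sub_zero, bin_one, Nat.choose_zero_right, Nat.choose_one_right]
        simp [bin_one, bin_zero]
        linear_combination zmod_two_add_self ((i : ZMod 2) + 1)
    · have e1 : 2 * (α + 1) + e = (2 * α + e) + 1 + 1 := by ring
      have e2 : (((i + 1 : ℕ) : ℤ) + ((α + 1 : ℕ) : ℤ) + e) = ((i : ℤ) + α + e) + 1 + 1 := by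
        push_cast; ring
      have h1 := ih (α + 1) e he
      have h2 := ih α e he
      rw [e1] at h1 ⊢
      rw [e2, binConv_succ_left, binConv_succ_upper]
      have e3 : (i : ℤ) + ((α + 1 : ℕ) : ℤ) + e = ((i : ℤ) + α + e) + 1 := by push_cast; ring
      have e4 : (i : ℤ) + α + e + 1 + 1 - 2 = (i : ℤ) + α + e := by ring
      rw [e3] at h1
      rw [h1, e4, binConv_succ_upper i _ (2 * α + e), h2, Nat.choose_succ_succ]
      push_cast
      linear_combination zmod_two_add_self (binConv i ((i : ℤ) + α + e) (2 * α + e + 1))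

/-- The coefficient of `x ^ a * y ^ b` in `x ^ e * (x ^ 2 + y) ^ p * (x * y) ^ q`. -/
def dicksonCoeff (e p q a b : ℕ) : ZMod 2 :=
  if a + 2 * b = e + 2 * p + 3 * q ∧ q ≤ b then (p.choose (b - q) : ZMod 2) else 0

lemma behrensCoeff_eq {a b c : ℕ} (hcb : c < b) (hca : c + 2 ≤ a) :
    behrensCoeff a b c = ((a + b - 2 * c - 2).choose (b - c) : ZMod 2) := by
  rw [behrensCoeff, if_pos]
  omega

lemma dicksonCoeff_rel (e p q a b : ℕ) (he : e = 2 ∨ e = 3) (hab : a ≤ b + 1) :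
    dicksonCoeff e p q a b =
      ∑ c ∈ Finset.range (a - 1), behrensCoeff a b c * dicksonCoeff e p q (a + 2 * b - 2 * c) c := by
  by_cases hw : a + 2 * b = e + 2 * p + 3 * q
  swap
  · rw [dicksonCoeff, if_neg (by tauto), Finset.sum_eq_zero]
    intro c hc
    rw [Finset.mem_range] at hc
    rw [dicksonCoeff, if_neg (by omega), mul_zero]
  have hsum : ∀ c ∈ Finset.range (a - 1), behrensCoeff a b c *
      dicksonCoeff e p q (a + 2 * b - 2 * c) c =
      if q ≤ c then ((a + b - 2 * c - 2).choose (b - c) : ZMod 2) * (p.choose (c - q) : ZMod 2)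
      else 0 := by
    intro c hc
    rw [Finset.mem_range] at hc
    rw [behrensCoeff_eq (by omega) (by omega), dicksonCoeff]
    by_cases hq : q ≤ c
    · rw [if_pos (by omega), if_pos hq]
    · rw [if_neg (by omega), if_neg hq, mul_zero]
  rw [Finset.sum_congr rfl hsum, dicksonCoeff]
  by_cases hA : e + q ≤ a
  · obtain ⟨α, hα⟩ : ∃ α, a = q + e + 2 * α := ⟨(a - q - e) / 2, by omega⟩
    have hb : b - q = p - α := by omega
    have hαp : α ≤ p := by omega
    rw [if_pos (by omega), hb, Nat.choose_symm hαp]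
    have hr : a - 1 = q + (2 * α + (e - 2) + 1) := by omega
    rw [hr, Finset.sum_range_add, Finset.sum_eq_zero (s := Finset.range q), zero_add,
      ← binConv_eq_choose p α (e - 2) (by omega), binConv]
    · refine Finset.sum_congr rfl fun c hc => ?_
      rw [Finset.mem_range] at hc
      rw [if_pos (by omega), mul_comm]
      have h1 : (p : ℤ) + α + ((e - 2 : ℕ) : ℤ) - 2 * c = ((p + α + (e - 2) - 2 * c : ℕ) : ℤ) := by
        omega
      rw [h1, bin_natCast, Nat.add_sub_cancel_left]
      have h2 : a + b - 2 * (q + c) - 2 = p + α + (e - 2) - 2 * c := by omega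
      rw [h2, ← Nat.choose_symm (by omega)]
      congr 3
      omega
    · intro c hc
      rw [Finset.mem_range] at hc
      rw [if_neg (by omega)]
  · rw [Finset.sum_eq_zero]
    · split_ifs with h
      · rw [Nat.choose_eq_zero_of_lt (by omega)]
        simp
      · rfl
    · intro c hc
      rw [Finset.mem_range] at hc
      rw [if_neg (by omega)]

/-! ### Functionals separating the admissible words of length three -/

/-- The polynomial ring in three variables whose monomials are the words of length three. -/
abbrev TriplePoly : Type := AddMonoidAlgebra (ZMod 2) (ℕ × ℕ × ℕ)

/-- The monomial of `TriplePoly` with the given exponents. -/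
def tmon (t : ℕ × ℕ × ℕ) : TriplePoly := AddMonoidAlgebra.single t 1

lemma tmon_mul (s t : ℕ × ℕ × ℕ) : tmon s * tmon t = tmon (s + t) := by
  simp [tmon, AddMonoidAlgebra.single_mul_single]

lemma tmon_pow (t : ℕ × ℕ × ℕ) (n : ℕ) : tmon t ^ n = tmon (n • t) := by
  simp [tmon, AddMonoidAlgebra.single_pow]

lemma tmon_coeff (s t : ℕ × ℕ × ℕ) : (tmon s).coeff t = if s = t then 1 else 0 := by
  classical
  simp [tmon, Finsupp.single_apply]

/-- The first variable. -/
def tX : TriplePoly := tmon (1, 0, 0)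
/-- The second variable. -/
def tY : TriplePoly := tmon (0, 1, 0)
/-- The third variable. -/
def tZ : TriplePoly := tmon (0, 0, 1)

lemma tmon_eq (a b c : ℕ) : tmon (a, b, c) = tX ^ a * tY ^ b * tZ ^ c := by
  simp [tX, tY, tZ, tmon_pow, tmon_mul]

/-- A function on words of length three which respects the Behrens relations in the first two
letters. -/
def RelL {M : Type*} [AddCommGroup M] [Module (ZMod 2) M] (φ : ℕ × ℕ × ℕ → M) (a b k : ℕ) : Prop :=
  φ (a, b, k) = ∑ c ∈ Finset.range (a - 1), behrensCoeff a b c • φ (a + 2 * b - 2 * c, c, k)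

/-- A function on words of length three which respects the Behrens relations in the last two
letters. -/
def RelR {M : Type*} [AddCommGroup M] [Module (ZMod 2) M] (φ : ℕ × ℕ × ℕ → M) (k a b : ℕ) : Prop :=
  φ (k, a, b) = ∑ c ∈ Finset.range (a - 1), behrensCoeff a b c • φ (k, a + 2 * b - 2 * c, c)

lemma dickson_expand {A : Type*} [CommRing A] (u v : A) (e p q : ℕ) :
    u ^ e * (u ^ 2 + v) ^ p * (u * v) ^ q =
      ∑ s ∈ Finset.range (p + 1), (p.choose s : A) * (u ^ (e + 2 * (p - s) + q) * v ^ (s + q)) := by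
  rw [add_comm (u ^ 2) v, add_pow, Finset.mul_sum, Finset.sum_mul]
  refine Finset.sum_congr rfl fun s _ => ?_
  rw [mul_pow, ← pow_mul, pow_add, pow_add, pow_add]
  ring

lemma dicksonCoeff_eq_sum (e p q a b : ℕ) :
    dicksonCoeff e p q a b = ∑ s ∈ Finset.range (p + 1),
      (p.choose s : ZMod 2) * (if e + 2 * (p - s) + q = a ∧ s + q = b then 1 else 0) := by
  rw [dicksonCoeff]
  split_ifs with h
  · by_cases hp : b - q ≤ p
    · rw [Finset.sum_eq_single (b - q)]
      · rw [if_pos (by omega), mul_one]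
      · intro s hs hne
        rw [Finset.mem_range] at hs
        rw [if_neg (by omega), mul_zero]
      · intro hn
        rw [Finset.mem_range] at hn
        omega
    · rw [Nat.choose_eq_zero_of_lt (by omega), Finset.sum_eq_zero]
      · simp
      · intro s hs
        rw [Finset.mem_range] at hs
        rw [if_neg (by omega), mul_zero]
  · rw [Finset.sum_eq_zero]
    intro s hs
    rw [Finset.mem_range] at hs
    rw [if_neg (by omega), mul_zero]

lemma natCast_mul_coeff (n : ℕ) (F : TriplePoly) (t : ℕ × ℕ × ℕ) :
    ((n : TriplePoly) * F).coeff t = (n : ZMod 2) * F.coeff t := by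
  have h : (n : TriplePoly) * F = (n : ZMod 2) • F := by rw [Algebra.smul_def, map_natCast]
  rw [h]
  rfl

lemma sum_coeff {ι : Type*} (s : Finset ι) (f : ι → TriplePoly) (t : ℕ × ℕ × ℕ) :
    (∑ i ∈ s, f i).coeff t = ∑ i ∈ s, (f i).coeff t := by
  classical
  induction s using Finset.induction_on with
  | empty => simp
  | insert i s hi ih => simp [Finset.sum_insert hi]

lemma left_coeff (e p q m a b c : ℕ) :
    (tX ^ e * (tX ^ 2 + tY) ^ p * (tX * tY) ^ q * tZ ^ m).coeff (a, b, c) =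
      if m = c then dicksonCoeff e p q a b else 0 := by
  rw [dickson_expand, Finset.sum_mul, sum_coeff, dicksonCoeff_eq_sum]
  have h : ∀ s ∈ Finset.range (p + 1),
      ((p.choose s : TriplePoly) * (tX ^ (e + 2 * (p - s) + q) * tY ^ (s + q)) * tZ ^ m).coeff
        (a, b, c) = if m = c then (p.choose s : ZMod 2) *
          (if e + 2 * (p - s) + q = a ∧ s + q = b then 1 else 0) else 0 := by
    intro s _
    rw [mul_assoc, natCast_mul_coeff, ← tmon_eq, tmon_coeff]
    simp only [Prod.mk.injEq]
    split_ifs <;> simp_all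
  rw [Finset.sum_congr rfl h]
  split_ifs <;> simp

lemma right_coeff (e p q m a b c : ℕ) :
    (tX ^ m * (tY ^ e * (tY ^ 2 + tZ) ^ p * (tY * tZ) ^ q)).coeff (a, b, c) =
      if m = a then dicksonCoeff e p q b c else 0 := by
  rw [dickson_expand, Finset.mul_sum, sum_coeff, dicksonCoeff_eq_sum]
  have h : ∀ s ∈ Finset.range (p + 1),
      (tX ^ m * ((p.choose s : TriplePoly) * (tY ^ (e + 2 * (p - s) + q) * tZ ^ (s + q)))).coeff
        (a, b, c) = if m = a then (p.choose s : ZMod 2) *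
          (if e + 2 * (p - s) + q = b ∧ s + q = c then 1 else 0) else 0 := by
    intro s _
    rw [mul_left_comm, natCast_mul_coeff, ← mul_assoc (tX ^ m), ← tmon_eq, tmon_coeff]
    simp only [Prod.mk.injEq]
    split_ifs <;> simp_all
  rw [Finset.sum_congr rfl h]
  split_ifs <;> simp

/-- Polynomials whose coefficients respect the Behrens relations in the first two letters. -/
def leftInv : Submodule (ZMod 2) TriplePoly :=
  Submodule.span (ZMod 2) {F | ∃ e p q m : ℕ, (e = 2 ∨ e = 3) ∧
    F = tX ^ e * (tX ^ 2 + tY) ^ p * (tX * tY) ^ q * tZ ^ m}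

/-- Polynomials whose coefficients respect the Behrens relations in the last two letters. -/
def rightInv : Submodule (ZMod 2) TriplePoly :=
  Submodule.span (ZMod 2) {F | ∃ e p q m : ℕ, (e = 2 ∨ e = 3) ∧
    F = tX ^ m * (tY ^ e * (tY ^ 2 + tZ) ^ p * (tY * tZ) ^ q)}

lemma leftInv_gen {e : ℕ} (p q m : ℕ) (he : e = 2 ∨ e = 3) :
    tX ^ e * (tX ^ 2 + tY) ^ p * (tX * tY) ^ q * tZ ^ m ∈ leftInv :=
  Submodule.subset_span ⟨e, p, q, m, he, rfl⟩

lemma rightInv_gen {e : ℕ} (p q m : ℕ) (he : e = 2 ∨ e = 3) :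
    tX ^ m * (tY ^ e * (tY ^ 2 + tZ) ^ p * (tY * tZ) ^ q) ∈ rightInv :=
  Submodule.subset_span ⟨e, p, q, m, he, rfl⟩

lemma relL_of_mem {F : TriplePoly} (hF : F ∈ leftInv) {a b : ℕ} (k : ℕ) (hab : a ≤ b + 1) :
    RelL (fun t => F.coeff t) a b k := by
  unfold RelL
  induction hF using Submodule.span_induction with
  | mem F h =>
    obtain ⟨e, p, q, m, he, rfl⟩ := h
    simp only [left_coeff]
    split_ifs
    · simpa using dicksonCoeff_rel e p q a b he hab
    · simp
  | zero => simp
  | add F G _ _ hF hG => simp [hF, hG, mul_add, Finset.sum_add_distrib]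
  | smul c F _ hF => simp [hF, Finset.mul_sum, mul_left_comm]

lemma relR_of_mem {F : TriplePoly} (hF : F ∈ rightInv) {a b : ℕ} (k : ℕ) (hab : a ≤ b + 1) :
    RelR (fun t => F.coeff t) k a b := by
  unfold RelR
  induction hF using Submodule.span_induction with
  | mem F h =>
    obtain ⟨e, p, q, m, he, rfl⟩ := h
    simp only [right_coeff]
    split_ifs
    · simpa using dicksonCoeff_rel e p q a b he hab
    · simp
  | zero => simp
  | add F G _ _ hF hG => simp [hF, hG, mul_add, Finset.sum_add_distrib]
  | smul c F _ hF => simp [hF, Finset.mul_sum, mul_left_comm]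

lemma mul_mem_span {A : Type*} [CommRing A] [Algebra (ZMod 2) A] {S : Set A} {t : A}
    (h : ∀ g ∈ S, t * g ∈ Submodule.span (ZMod 2) S) {F : A}
    (hF : F ∈ Submodule.span (ZMod 2) S) : t * F ∈ Submodule.span (ZMod 2) S := by
  induction hF using Submodule.span_induction with
  | mem F hF => exact h F hF
  | zero => simp
  | add F G _ _ hF hG => rw [mul_add]; exact add_mem hF hG
  | smul c F _ hF => rw [mul_smul_comm]; exact Submodule.smul_mem _ _ hF

lemma leftInv_mul_d {F : TriplePoly} (hF : F ∈ leftInv) : (tX ^ 2 + tY) * F ∈ leftInv := by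
  refine mul_mem_span ?_ hF
  rintro _ ⟨e, p, q, m, he, rfl⟩
  change _ ∈ leftInv
  convert leftInv_gen (p + 1) q m he using 1
  ring

lemma leftInv_mul_D {F : TriplePoly} (hF : F ∈ leftInv) : (tX * tY) * F ∈ leftInv := by
  refine mul_mem_span ?_ hF
  rintro _ ⟨e, p, q, m, he, rfl⟩
  change _ ∈ leftInv
  convert leftInv_gen p (q + 1) m he using 1
  ring

lemma leftInv_mul_Z {F : TriplePoly} (hF : F ∈ leftInv) : tZ * F ∈ leftInv := by
  refine mul_mem_span ?_ hF
  rintro _ ⟨e, p, q, m, he, rfl⟩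
  change _ ∈ leftInv
  convert leftInv_gen p q (m + 1) he using 1
  ring

lemma rightInv_mul_d {F : TriplePoly} (hF : F ∈ rightInv) : (tY ^ 2 + tZ) * F ∈ rightInv := by
  refine mul_mem_span ?_ hF
  rintro _ ⟨e, p, q, m, he, rfl⟩
  change _ ∈ rightInv
  convert rightInv_gen (p + 1) q m he using 1
  ring

lemma rightInv_mul_D {F : TriplePoly} (hF : F ∈ rightInv) : (tY * tZ) * F ∈ rightInv := by
  refine mul_mem_span ?_ hF
  rintro _ ⟨e, p, q, m, he, rfl⟩
  change _ ∈ rightInv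
  convert rightInv_gen p (q + 1) m he using 1
  ring

lemma rightInv_mul_X {F : TriplePoly} (hF : F ∈ rightInv) : tX * F ∈ rightInv := by
  refine mul_mem_span ?_ hF
  rintro _ ⟨e, p, q, m, he, rfl⟩
  change _ ∈ rightInv
  convert rightInv_gen p q (m + 1) he using 1
  ring

/-- The Dickson invariant of degree seven. -/
def dickson₀ : TriplePoly := tX * tY * tZ
/-- The Dickson invariant of degree six. -/
def dickson₁ : TriplePoly := tX ^ 2 * tY ^ 2 + tX ^ 2 * tZ + tY * tZ
/-- The Dickson invariant of degree four. -/
def dickson₂ : TriplePoly := tX ^ 4 + tY ^ 2 + tZ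

lemma two_eq_zero_triplePoly : (2 : TriplePoly) = 0 := by
  have h : ((2 : ℕ) : TriplePoly) = 0 := by
    rw [← map_natCast (algebraMap (ZMod 2) TriplePoly)]
    have : ((2 : ℕ) : ZMod 2) = 0 := by decide
    rw [this, map_zero]
  exact_mod_cast h

/-- The polynomials respecting the Behrens relations in both pairs of adjacent letters. -/
def bothInv : Submodule (ZMod 2) TriplePoly := leftInv ⊓ rightInv

lemma dickson₀_mul {F : TriplePoly} (hF : F ∈ bothInv) : dickson₀ * F ∈ bothInv := by
  refine Submodule.mem_inf.2 ⟨?_, ?_⟩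
  · convert leftInv_mul_D (leftInv_mul_Z hF.1) using 1
    rw [dickson₀]; ring
  · convert rightInv_mul_D (rightInv_mul_X hF.2) using 1
    rw [dickson₀]; ring

lemma dickson₁_mul {F : TriplePoly} (hF : F ∈ bothInv) : dickson₁ * F ∈ bothInv := by
  refine Submodule.mem_inf.2 ⟨?_, ?_⟩
  · convert add_mem (leftInv_mul_D (leftInv_mul_D hF.1)) (leftInv_mul_d (leftInv_mul_Z hF.1))
      using 1
    rw [dickson₁]; ring
  · convert add_mem (rightInv_mul_X (rightInv_mul_X (rightInv_mul_d hF.2)))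
      (rightInv_mul_D hF.2) using 1
    rw [dickson₁]; ring

lemma dickson₂_mul {F : TriplePoly} (hF : F ∈ bothInv) : dickson₂ * F ∈ bothInv := by
  refine Submodule.mem_inf.2 ⟨?_, ?_⟩
  · convert add_mem (leftInv_mul_d (leftInv_mul_d hF.1)) (leftInv_mul_Z hF.1) using 1
    rw [dickson₂]
    linear_combination (- tX ^ 2 * tY * F) * two_eq_zero_triplePoly
  · convert add_mem (rightInv_mul_X (rightInv_mul_X (rightInv_mul_X (rightInv_mul_X hF.2))))
      (rightInv_mul_d hF.2) using 1
    rw [dickson₂]; ring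

lemma pow_mul_mem {t : TriplePoly} (h : ∀ F ∈ bothInv, t * F ∈ bothInv) (n : ℕ) {F : TriplePoly}
    (hF : F ∈ bothInv) : t ^ n * F ∈ bothInv := by
  induction n with
  | zero => simpa using hF
  | succ n ih => rw [pow_succ', mul_assoc]; exact h _ ih

/-- The strict order on exponents: third exponent first, then the second. -/
def TLt (s t : ℕ × ℕ × ℕ) : Prop := s.2.2 < t.2.2 ∨ (s.2.2 = t.2.2 ∧ s.2.1 < t.2.1)

/-- The span of the monomials with exponents above `s`. -/
def tAbove (s : ℕ × ℕ × ℕ) : Submodule (ZMod 2) TriplePoly :=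
  Submodule.span (ZMod 2) (tmon '' {t | TLt s t})

/-- `F` is the monomial with exponent `s` plus monomials with exponents above `s`. -/
def TLead (F : TriplePoly) (s : ℕ × ℕ × ℕ) : Prop := ∃ G ∈ tAbove s, F = tmon s + G

lemma tmon_mem_tAbove {s t : ℕ × ℕ × ℕ} (h : TLt s t) : tmon t ∈ tAbove s :=
  Submodule.subset_span ⟨t, h, rfl⟩

lemma tmon_mul_mem_tAbove (s : ℕ × ℕ × ℕ) {t : ℕ × ℕ × ℕ} {G : TriplePoly} (hG : G ∈ tAbove t) :
    tmon s * G ∈ tAbove (s + t) := by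
  induction hG using Submodule.span_induction with
  | mem F hF =>
    obtain ⟨r, hr, rfl⟩ := hF
    rw [tmon_mul]
    refine tmon_mem_tAbove ?_
    simp only [TLt, Set.mem_ofPred_eq, Prod.fst_add, Prod.snd_add] at hr ⊢
    omega
  | zero => simp
  | add F G _ _ hF hG => rw [mul_add]; exact add_mem hF hG
  | smul c F _ hF => rw [mul_smul_comm]; exact Submodule.smul_mem _ _ hF

lemma mul_mem_tAbove {s t : ℕ × ℕ × ℕ} {F G : TriplePoly} (hF : F ∈ tAbove s) (hG : G ∈ tAbove t) :
    F * G ∈ tAbove (s + t) := by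
  induction hF using Submodule.span_induction with
  | mem F hF =>
    obtain ⟨r, hr, rfl⟩ := hF
    refine Submodule.span_mono (Set.image_mono ?_) (tmon_mul_mem_tAbove r hG)
    intro u hu
    simp only [TLt, Set.mem_ofPred_eq, Prod.fst_add, Prod.snd_add] at hr hu ⊢
    omega
  | zero => simp
  | add F G _ _ hF hG => rw [add_mul]; exact add_mem hF hG
  | smul c F _ hF => rw [smul_mul_assoc]; exact Submodule.smul_mem _ _ hF

lemma TLead.mul {s t : ℕ × ℕ × ℕ} {F G : TriplePoly} (hF : TLead F s) (hG : TLead G t) :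
    TLead (F * G) (s + t) := by
  obtain ⟨F', hF', rfl⟩ := hF
  obtain ⟨G', hG', rfl⟩ := hG
  refine ⟨tmon s * G' + tmon t * F' + F' * G', ?_, ?_⟩
  · refine add_mem (add_mem (tmon_mul_mem_tAbove s hG') ?_) (mul_mem_tAbove hF' hG')
    rw [add_comm s t]
    exact tmon_mul_mem_tAbove t hF'
  · rw [← tmon_mul]
    ring

lemma TLead.pow {s : ℕ × ℕ × ℕ} {F : TriplePoly} (hF : TLead F s) (n : ℕ) :
    TLead (F ^ n) (n • s) := by
  induction n with
  | zero => exact ⟨0, zero_mem _, by simp [tmon, AddMonoidAlgebra.one_def]⟩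
  | succ n ih => rw [pow_succ, succ_nsmul]; exact ih.mul hF

lemma tLead_dickson₀ : TLead dickson₀ (1, 1, 1) :=
  ⟨0, zero_mem _, by simp [dickson₀, tmon_eq]⟩

lemma tLead_dickson₁ : TLead dickson₁ (2, 2, 0) := by
  refine ⟨tmon (2, 0, 1) + tmon (0, 1, 1), add_mem (tmon_mem_tAbove ?_) (tmon_mem_tAbove ?_), ?_⟩
  · simp [TLt]
  · simp [TLt]
  · simp [dickson₁, tmon_eq, add_assoc]

lemma tLead_dickson₂ : TLead dickson₂ (4, 0, 0) := by
  refine ⟨tmon (0, 2, 0) + tmon (0, 0, 1), add_mem (tmon_mem_tAbove ?_) (tmon_mem_tAbove ?_), ?_⟩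
  · simp [TLt]
  · simp [TLt]
  · simp [dickson₂, tmon_eq, add_assoc]

lemma exists_bothInv_generator (b r : ℕ) (hb : b = 2 ∨ b = 3) (hr : r < 4) :
    ∃ F ∈ bothInv, TLead F (b + 2 + r, b, 0) := by
  have key : ∀ (F G : TriplePoly) (s : ℕ × ℕ × ℕ), F = tmon s + G → G ∈ tAbove s → F ∈ leftInv →
      F ∈ rightInv → ∃ F ∈ bothInv, TLead F s :=
    fun F G s h hG hl hr => ⟨F, ⟨hl, hr⟩, G, hG, h⟩
  rcases hb with rfl | rfl
  · interval_cases r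
    · refine key (tmon (4, 2, 0)) 0 _ (by simp) (zero_mem _) ?_ ?_
      · convert leftInv_gen 0 2 0 (Or.inl rfl) using 1
        rw [tmon_eq]; ring
      · convert rightInv_gen 0 0 4 (Or.inl rfl) using 1
        rw [tmon_eq]; ring
    · refine key (tmon (5, 2, 0)) 0 _ (by simp) (zero_mem _) ?_ ?_
      · convert leftInv_gen 0 2 0 (Or.inr rfl) using 1
        rw [tmon_eq]; ring
      · convert rightInv_gen 0 0 5 (Or.inl rfl) using 1
        rw [tmon_eq]; ring
    · refine key (tmon (6, 2, 0) + tmon (4, 3, 0)) _ _ rfl (tmon_mem_tAbove (by simp [TLt])) ?_ ?_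
      · convert leftInv_gen 1 2 0 (Or.inl rfl) using 1
        rw [tmon_eq, tmon_eq]; ring
      · convert add_mem (rightInv_gen 0 0 6 (Or.inl rfl)) (rightInv_gen 0 0 4 (Or.inr rfl)) using 1
        rw [tmon_eq, tmon_eq]; ring
    · refine key (tmon (7, 2, 0) + tmon (5, 3, 0)) _ _ rfl (tmon_mem_tAbove (by simp [TLt])) ?_ ?_
      · convert leftInv_gen 1 2 0 (Or.inr rfl) using 1
        rw [tmon_eq, tmon_eq]; ring
      · convert add_mem (rightInv_gen 0 0 7 (Or.inl rfl)) (rightInv_gen 0 0 5 (Or.inr rfl)) using 1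
        rw [tmon_eq, tmon_eq]; ring
  · interval_cases r
    · refine key (tmon (5, 3, 0)) 0 _ (by simp) (zero_mem _) ?_ ?_
      · convert leftInv_gen 0 3 0 (Or.inl rfl) using 1
        rw [tmon_eq]; ring
      · convert rightInv_gen 0 0 5 (Or.inr rfl) using 1
        rw [tmon_eq]; ring
    · refine key (tmon (6, 3, 0)) 0 _ (by simp) (zero_mem _) ?_ ?_
      · convert leftInv_gen 0 3 0 (Or.inr rfl) using 1
        rw [tmon_eq]; ring
      · convert rightInv_gen 0 0 6 (Or.inr rfl) using 1
        rw [tmon_eq]; ring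
    · refine key (tmon (7, 3, 0) + (tmon (5, 4, 0) + tmon (5, 2, 1))) _ _ rfl
        (add_mem (tmon_mem_tAbove (by simp [TLt])) (tmon_mem_tAbove (by simp [TLt]))) ?_ ?_
      · convert add_mem (leftInv_gen 1 3 0 (Or.inl rfl)) (leftInv_gen 0 2 1 (Or.inr rfl)) using 1
        simp only [tmon_eq]; ring
      · convert add_mem (rightInv_gen 0 0 7 (Or.inr rfl)) (rightInv_gen 1 0 5 (Or.inl rfl)) using 1
        simp only [tmon_eq]; ring
    · refine key (tmon (8, 3, 0) + (tmon (6, 4, 0) + tmon (6, 2, 1) + tmon (4, 3, 1))) _ _ rfl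
        (add_mem (add_mem (tmon_mem_tAbove (by simp [TLt])) (tmon_mem_tAbove (by simp [TLt])))
          (tmon_mem_tAbove (by simp [TLt]))) ?_ ?_
      · convert add_mem (leftInv_gen 1 3 0 (Or.inr rfl)) (leftInv_gen 1 2 1 (Or.inl rfl)) using 1
        simp only [tmon_eq]; ring
      · convert add_mem (add_mem (rightInv_gen 0 0 8 (Or.inr rfl))
          (rightInv_gen 1 0 6 (Or.inl rfl))) (rightInv_gen 0 1 4 (Or.inl rfl)) using 1
        simp only [tmon_eq]; ring

lemma exists_bothInv_tLead {a b c : ℕ} (hab : b + 1 < a) (hbc : c + 1 < b) :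
    ∃ F ∈ bothInv, TLead F (a, b, c) := by
  obtain ⟨j, b₀, hb₀, hb⟩ : ∃ j b₀, (b₀ = 2 ∨ b₀ = 3) ∧ b = b₀ + 2 * j + c :=
    ⟨(b - c - 2) / 2, 2 + (b - c - 2) % 2, by omega, by omega⟩
  obtain ⟨k, r, hr, ha⟩ : ∃ k r, r < 4 ∧ a = b + 2 + r + 4 * k :=
    ⟨(a - b - 2) / 4, (a - b - 2) % 4, by omega, by omega⟩
  obtain ⟨F, hF, hlead⟩ := exists_bothInv_generator b₀ r hb₀ hr
  refine ⟨dickson₀ ^ c * (dickson₁ ^ j * (dickson₂ ^ k * F)),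
    pow_mul_mem (fun _ => dickson₀_mul) c (pow_mul_mem (fun _ => dickson₁_mul) j
      (pow_mul_mem (fun _ => dickson₂_mul) k hF)), ?_⟩
  convert (tLead_dickson₀.pow c).mul ((tLead_dickson₁.pow j).mul ((tLead_dickson₂.pow k).mul hlead))
    using 1
  simp only [Prod.smul_mk, Prod.mk_add_mk, Prod.mk.injEq, smul_eq_mul]
  omega

lemma coeff_eq_zero_of_mem_tAbove {s t : ℕ × ℕ × ℕ} {G : TriplePoly} (hG : G ∈ tAbove s)
    (ht : ¬ TLt s t) : G.coeff t = 0 := by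
  induction hG using Submodule.span_induction with
  | mem F hF =>
    obtain ⟨r, hr, rfl⟩ := hF
    rw [tmon_coeff, if_neg]
    rintro rfl
    exact ht hr
  | zero => simp
  | add F G _ _ hF hG => simp [hF, hG]
  | smul c F _ hF => simp [hF]

/-- The admissible words of length three. -/
def AdmTriple : Set (ℕ × ℕ × ℕ) := {t | t.2.1 + 1 < t.1 ∧ t.2.2 + 1 < t.2.1}

lemma eq_zero_of_supported_admTriple {y : ℕ × ℕ × ℕ →₀ ZMod 2}
    (hy : y ∈ Finsupp.supported (ZMod 2) (ZMod 2) AdmTriple)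
    (h : ∀ φ : ℕ × ℕ × ℕ → ZMod 2, (∀ a b k, a ≤ b + 1 → RelL φ a b k) →
      (∀ k a b, a ≤ b + 1 → RelR φ k a b) → Finsupp.linearCombination (ZMod 2) φ y = 0) :
    y = 0 := by
  by_contra hne
  obtain ⟨s, hs, hmax⟩ := Finset.exists_max_image y.support
    (fun t => toLex (t.2.2, t.2.1)) (Finsupp.support_nonempty_iff.2 hne)
  obtain ⟨a, b, c⟩ := s
  obtain ⟨hab, hbc⟩ := (Finsupp.mem_supported _ _).1 hy hs
  obtain ⟨F, hF, G, hG, rfl⟩ := exists_bothInv_tLead hab hbc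
  have h0 := h (fun t => (tmon (a, b, c) + G).coeff t)
    (fun a b k hab => relL_of_mem hF.1 k hab) (fun k a b hab => relR_of_mem hF.2 k hab)
  rw [Finsupp.linearCombination_apply, Finsupp.sum, Finset.sum_eq_single (a, b, c)] at h0
  · rw [AddMonoidAlgebra.coeff_add, Finsupp.add_apply,
      coeff_eq_zero_of_mem_tAbove hG (by simp [TLt]), tmon_coeff] at h0
    simp at h0
    exact Finsupp.mem_support_iff.1 hs h0
  · intro t ht hne
    have hle := hmax t ht
    rw [Prod.Lex.toLex_le_toLex] at hle
    have hlt : ¬ TLt (a, b, c) t := by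
      simp only [TLt] at hle ⊢
      omega
    rw [AddMonoidAlgebra.coeff_add, Finsupp.add_apply, coeff_eq_zero_of_mem_tAbove hG hlt,
      tmon_coeff, if_neg (Ne.symm hne)]
    simp
  · intro hn
    exact absurd hs hn

/-- The overlap of two Behrens relations resolves. -/
lemma overlap_resolves {M : Type*} [AddCommGroup M] [Module (ZMod 2) M] (Θ : ℕ × ℕ × ℕ → M)
    {a b d : ℕ} (hab : a ≤ b + 1) (hbd : b ≤ d + 1)
    (hL : ∀ p q r, p + 2 * q + 4 * r = a + 2 * b + 4 * d → a + b + d < p + q + r →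
      p ≤ q + 1 → RelL Θ p q r)
    (hR : ∀ p q r, p + 2 * q + 4 * r = a + 2 * b + 4 * d → a + b + d < p + q + r →
      q ≤ r + 1 → RelR Θ p q r) :
    ∑ c ∈ Finset.range (a - 1), behrensCoeff a b c • Θ (a + 2 * b - 2 * c, c, d) =
      ∑ c ∈ Finset.range (b - 1), behrensCoeff b d c • Θ (a, b + 2 * d - 2 * c, c) := by
  let V := ℕ × ℕ × ℕ →₀ ZMod 2
  let redL : ℕ → ℕ → ℕ → V := fun p q r => ∑ c ∈ Finset.range (p - 1),
    behrensCoeff p q c • Finsupp.single (p + 2 * q - 2 * c, c, r) 1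
  let redR : ℕ → ℕ → ℕ → V := fun p q r => ∑ c ∈ Finset.range (q - 1),
    behrensCoeff q r c • Finsupp.single (p, q + 2 * r - 2 * c, c) 1
  let U : Submodule (ZMod 2) V :=
    { carrier := {v | Finsupp.linearCombination (ZMod 2) Θ v = 0 ∧
        ∀ φ : ℕ × ℕ × ℕ → ZMod 2, (∀ a b k, a ≤ b + 1 → RelL φ a b k) →
          (∀ k a b, a ≤ b + 1 → RelR φ k a b) → Finsupp.linearCombination (ZMod 2) φ v = 0}
      add_mem' := fun {u v} hu hv => ⟨by rw [map_add, hu.1, hv.1, add_zero],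
        fun φ h1 h2 => by rw [map_add, hu.2 φ h1 h2, hv.2 φ h1 h2, add_zero]⟩
      zero_mem' := ⟨map_zero _, fun _ _ _ => map_zero _⟩
      smul_mem' := fun c v hv => ⟨by rw [map_smul, hv.1, smul_zero],
        fun φ h1 h2 => by rw [map_smul, hv.2 φ h1 h2, smul_zero]⟩ }
  have lc : ∀ {N : Type _} [AddCommGroup N] [Module (ZMod 2) N] (φ : ℕ × ℕ × ℕ → N) (t),
      Finsupp.linearCombination (ZMod 2) φ (Finsupp.single t 1) = φ t := by
    intro N _ _ φ t
    simp
  have mem_sup : ∀ n p q r, q + 3 * r = n → p + 2 * q + 4 * r = a + 2 * b + 4 * d →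
      a + b + d < p + q + r →
      (Finsupp.single (p, q, r) 1 : V) ∈ Finsupp.supported (ZMod 2) (ZMod 2) AdmTriple ⊔ U := by
    intro n
    induction n using Nat.strong_induction_on with
    | _ n ih =>
      intro p q r hn hw hs
      by_cases h1 : p ≤ q + 1
      · have hU : (Finsupp.single (p, q, r) 1 : V) - redL p q r ∈ U := by
          refine ⟨?_, fun φ h _ => ?_⟩
          · rw [map_sub, lc, map_sum, hL p q r hw hs h1, sub_eq_zero]
            exact Finset.sum_congr rfl fun c _ => by rw [map_smul, lc]
          · rw [map_sub, Finsupp.linearCombination_single, map_sum, one_smul, h p q r h1,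
              sub_eq_zero]
            exact Finset.sum_congr rfl fun c _ => by
              rw [map_smul, Finsupp.linearCombination_single, one_smul]
        rw [← sub_add_cancel (Finsupp.single (p, q, r) 1 : V) (redL p q r)]
        refine add_mem (Submodule.mem_sup_right hU) (sum_mem fun c hc => Submodule.smul_mem _ _ ?_)
        rw [Finset.mem_range] at hc
        exact ih (c + 3 * r) (by omega) _ _ _ rfl (by omega) (by omega)
      · by_cases h2 : q ≤ r + 1
        · have hU : (Finsupp.single (p, q, r) 1 : V) - redR p q r ∈ U := by
            refine ⟨?_, fun φ _ h => ?_⟩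
            · rw [map_sub, lc, map_sum, hR p q r hw hs h2, sub_eq_zero]
              exact Finset.sum_congr rfl fun c _ => by rw [map_smul, lc]
            · rw [map_sub, Finsupp.linearCombination_single, map_sum, one_smul, h p q r h2,
                sub_eq_zero]
              exact Finset.sum_congr rfl fun c _ => by
                rw [map_smul, Finsupp.linearCombination_single, one_smul]
          rw [← sub_add_cancel (Finsupp.single (p, q, r) 1 : V) (redR p q r)]
          refine add_mem (Submodule.mem_sup_right hU)
            (sum_mem fun c hc => Submodule.smul_mem _ _ ?_)
          rw [Finset.mem_range] at hc
          exact ih (q + 2 * r - 2 * c + 3 * c) (by omega) _ _ _ rfl (by omega) (by omega)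
        · refine Submodule.mem_sup_left (Finsupp.single_mem_supported _ _ ?_)
          simp only [AdmTriple, Set.mem_ofPred_eq]
          omega
  have hmem : redL a b d - redR a b d ∈ Finsupp.supported (ZMod 2) (ZMod 2) AdmTriple ⊔ U := by
    refine sub_mem (sum_mem fun c hc => Submodule.smul_mem _ _ ?_)
      (sum_mem fun c hc => Submodule.smul_mem _ _ ?_)
    · rw [Finset.mem_range] at hc
      exact mem_sup _ _ _ _ rfl (by omega) (by omega)
    · rw [Finset.mem_range] at hc
      exact mem_sup _ _ _ _ rfl (by omega) (by omega)
  obtain ⟨y, hy, u, hu, hyu⟩ := Submodule.mem_sup.1 hmem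
  have hy0 : y = 0 := by
    refine eq_zero_of_supported_admTriple hy fun φ h1 h2 => ?_
    have h3 : Finsupp.linearCombination (ZMod 2) φ (redL a b d - redR a b d) = 0 := by
      rw [map_sub, sub_eq_zero, map_sum, map_sum]
      refine Eq.trans (Eq.trans ?_ ((h1 a b d hab).symm.trans (h2 a b d hbd))) ?_
      · exact Finset.sum_congr rfl fun c _ => by
          rw [map_smul, Finsupp.linearCombination_single, one_smul]
      · exact Finset.sum_congr rfl fun c _ => by
          rw [map_smul, Finsupp.linearCombination_single, one_smul]
    rw [← hyu, map_add, hu.2 φ h1 h2, add_zero] at h3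
    exact h3
  have h4 : Finsupp.linearCombination (ZMod 2) Θ (redL a b d - redR a b d) = 0 := by
    rw [← hyu, hy0, zero_add, hu.1]
  rw [map_sub, sub_eq_zero, map_sum, map_sum] at h4
  simpa only [map_smul, lc] using h4

/-! ### Words and their normal forms -/

/-- The weight of a word, which is preserved by the Behrens relations. -/
def wordWeight : List ℕ → ℕ
  | [] => 0
  | a :: u => a + 2 * wordWeight u

lemma wordWeight_append (u v : List ℕ) :
    wordWeight (u ++ v) = wordWeight u + 2 ^ u.length * wordWeight v := by
  induction u with
  | nil => simp [wordWeight]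
  | cons a u ih => rw [List.cons_append, wordWeight, ih, wordWeight, List.length_cons]; ring

lemma sum_le_wordWeight (u : List ℕ) : u.sum ≤ wordWeight u := by
  induction u with
  | nil => simp
  | cons a u ih => rw [List.sum_cons, wordWeight]; omega

/-- The defect of a word, which decreases under rewriting. -/
def wordRank (u : List ℕ) : ℕ := wordWeight u - u.sum

/-- `v` may occur in a rewriting of `u`. -/
def WordLe (v u : List ℕ) : Prop :=
  v.length = u.length ∧ wordWeight v = wordWeight u ∧ u.sum ≤ v.sum

/-- `v` may occur in a proper rewriting of `u`. -/
def WordLt (v u : List ℕ) : Prop :=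
  v.length = u.length ∧ wordWeight v = wordWeight u ∧ u.sum < v.sum

lemma WordLt.le {v u : List ℕ} (h : WordLt v u) : WordLe v u := ⟨h.1, h.2.1, h.2.2.le⟩

lemma WordLe.refl (u : List ℕ) : WordLe u u := ⟨rfl, rfl, le_rfl⟩

lemma WordLe.trans {u v w : List ℕ} (h : WordLe u v) (h' : WordLe v w) : WordLe u w :=
  ⟨h.1.trans h'.1, h.2.1.trans h'.2.1, h'.2.2.trans h.2.2⟩

lemma WordLe.trans_lt {u v w : List ℕ} (h : WordLe u v) (h' : WordLt v w) : WordLt u w :=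
  ⟨h.1.trans h'.1, h.2.1.trans h'.2.1, h'.2.2.trans_le h.2.2⟩

lemma WordLt.rank_lt {v u : List ℕ} (h : WordLt v u) : wordRank v < wordRank u := by
  have h1 := sum_le_wordWeight v
  obtain ⟨-, h2, h3⟩ := h
  unfold wordRank
  omega

lemma WordLe.append {u v u' v' : List ℕ} (h : WordLe u u') (h' : WordLe v v') :
    WordLe (u ++ v) (u' ++ v') := by
  obtain ⟨h1, h2, h3⟩ := h
  obtain ⟨h4, h5, h6⟩ := h'
  refine ⟨by simp [h1, h4], by rw [wordWeight_append, wordWeight_append, h1, h2, h5], ?_⟩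
  rw [List.sum_append, List.sum_append]
  omega

lemma WordLe.append_lt {u v u' v' : List ℕ} (h : WordLe u u') (h' : WordLt v v') :
    WordLt (u ++ v) (u' ++ v') := by
  refine ⟨(h.append h'.le).1, (h.append h'.le).2.1, ?_⟩
  rw [List.sum_append, List.sum_append]
  exact add_lt_add_of_le_of_lt h.2.2 h'.2.2

lemma WordLt.append_le {u v u' v' : List ℕ} (h : WordLt u u') (h' : WordLe v v') :
    WordLt (u ++ v) (u' ++ v') := by
  refine ⟨(h.le.append h').1, (h.le.append h').2.1, ?_⟩
  rw [List.sum_append, List.sum_append]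
  exact add_lt_add_of_lt_of_le h.2.2 h'.2.2

lemma wordLt_step (pre post : List ℕ) {a b c : ℕ} (hab : a ≤ b + 1) (hc : c < a - 1) :
    WordLt (pre ++ (a + 2 * b - 2 * c) :: c :: post) (pre ++ a :: b :: post) := by
  refine (WordLe.refl pre).append_lt ⟨by simp, ?_, ?_⟩
  · simp only [wordWeight]
    omega
  · simp only [List.sum_cons]
    omega

/-- The admissible words. -/
def Adm (u : List ℕ) : Prop := List.IsChain (fun a b => b + 1 < a) u

lemma not_adm_iff (u : List ℕ) :
    ¬ Adm u ↔ ∃ pre a b post, u = pre ++ a :: b :: post ∧ a ≤ b + 1 := by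
  rw [Adm, List.isChain_iff_forall_rel_of_append_cons_cons]
  push Not
  constructor
  · rintro ⟨a, b, pre, post, h, hab⟩
    exact ⟨pre, a, b, post, h, hab⟩
  · rintro ⟨pre, a, b, post, h, hab⟩
    exact ⟨a, b, pre, post, h, hab⟩

open Classical in
/-- The normal form of a word. -/
def nf (u : List ℕ) : List ℕ →₀ ZMod 2 :=
  if h : ∃ t : List ℕ × ℕ × ℕ × List ℕ,
      u = t.1 ++ t.2.1 :: t.2.2.1 :: t.2.2.2 ∧ t.2.1 ≤ t.2.2.1 + 1 then
    ∑ c : Fin (h.choose.2.1 - 1), behrensCoeff h.choose.2.1 h.choose.2.2.1 c •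
      nf (h.choose.1 ++ (h.choose.2.1 + 2 * h.choose.2.2.1 - 2 * (c : ℕ)) :: (c : ℕ) ::
        h.choose.2.2.2)
  else Finsupp.single u 1
termination_by wordRank u
decreasing_by
  have hu := h.choose_spec.1
  conv_rhs => rw [hu]
  exact (wordLt_step _ _ h.choose_spec.2 c.2).rank_lt

lemma nf_of_adm {u : List ℕ} (h : Adm u) : nf u = Finsupp.single u 1 := by
  rw [nf, dif_neg]
  rintro ⟨t, ht, hab⟩
  exact (not_adm_iff u).2 ⟨_, _, _, _, ht, hab⟩ h

/-- The sum of the normal forms of the terms of a one-step rewriting. -/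
def nfStep (pre : List ℕ) (a b : ℕ) (post : List ℕ) : List ℕ →₀ ZMod 2 :=
  ∑ c ∈ Finset.range (a - 1), behrensCoeff a b c • nf (pre ++ (a + 2 * b - 2 * c) :: c :: post)

lemma exists_nf_eq_nfStep {u : List ℕ} (h : ¬ Adm u) :
    ∃ pre a b post, u = pre ++ a :: b :: post ∧ a ≤ b + 1 ∧ nf u = nfStep pre a b post := by
  obtain ⟨pre, a, b, post, hu, hab⟩ := (not_adm_iff u).1 h
  have h' : ∃ t : List ℕ × ℕ × ℕ × List ℕ,
      u = t.1 ++ t.2.1 :: t.2.2.1 :: t.2.2.2 ∧ t.2.1 ≤ t.2.2.1 + 1 :=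
    ⟨(pre, a, b, post), hu, hab⟩
  refine ⟨_, _, _, _, h'.choose_spec.1, h'.choose_spec.2, ?_⟩
  rw [nf, dif_pos h', nfStep, Finset.sum_range]

lemma nfStep_disjoint {n : ℕ}
    (ih : ∀ pre a b post, wordRank (pre ++ a :: b :: post) < n → a ≤ b + 1 →
      nf (pre ++ a :: b :: post) = nfStep pre a b post)
    (pre : List ℕ) {a b : ℕ} (t : List ℕ) {a' b' : ℕ} (post : List ℕ)
    (hn : wordRank (pre ++ a :: b :: (t ++ a' :: b' :: post)) = n)
    (hab : a ≤ b + 1) (hab' : a' ≤ b' + 1) :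
    nfStep pre a b (t ++ a' :: b' :: post) = nfStep (pre ++ a :: b :: t) a' b' post := by
  have h1 : ∀ c ∈ Finset.range (a - 1), behrensCoeff a b c •
      nf (pre ++ (a + 2 * b - 2 * c) :: c :: (t ++ a' :: b' :: post)) =
      ∑ c' ∈ Finset.range (a' - 1), behrensCoeff a b c • behrensCoeff a' b' c' •
        nf (pre ++ (a + 2 * b - 2 * c) :: c :: (t ++ (a' + 2 * b' - 2 * c') :: c' :: post)) := by
    intro c hc
    have h := ih (pre ++ (a + 2 * b - 2 * c) :: c :: t) a' b' post
    simp only [List.append_assoc, List.cons_append] at h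
    rw [h (hn ▸ (wordLt_step _ _ hab (Finset.mem_range.1 hc)).rank_lt) hab', nfStep,
      Finset.smul_sum]
    simp only [List.append_assoc, List.cons_append]
  have h2 : ∀ c' ∈ Finset.range (a' - 1), behrensCoeff a' b' c' •
      nf (pre ++ a :: b :: t ++ (a' + 2 * b' - 2 * c') :: c' :: post) =
      ∑ c ∈ Finset.range (a - 1), behrensCoeff a b c • behrensCoeff a' b' c' •
        nf (pre ++ (a + 2 * b - 2 * c) :: c :: (t ++ (a' + 2 * b' - 2 * c') :: c' :: post)) := by
    intro c' hc'
    have h := wordLt_step (pre ++ a :: b :: t) post hab' (Finset.mem_range.1 hc')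
    simp only [List.append_assoc, List.cons_append] at h ⊢
    rw [ih pre a b _ (hn ▸ h.rank_lt) hab, nfStep, Finset.smul_sum]
    exact Finset.sum_congr rfl fun c _ => smul_comm _ _ _
  rw [nfStep, nfStep, Finset.sum_congr rfl h1, Finset.sum_congr rfl h2, Finset.sum_comm]

lemma nfStep_overlap {n : ℕ}
    (ih : ∀ pre a b post, wordRank (pre ++ a :: b :: post) < n → a ≤ b + 1 →
      nf (pre ++ a :: b :: post) = nfStep pre a b post)
    (pre : List ℕ) {a b d : ℕ} (post : List ℕ)
    (hn : wordRank (pre ++ a :: b :: d :: post) = n) (hab : a ≤ b + 1) (hbd : b ≤ d + 1) :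
    nfStep pre a b (d :: post) = nfStep (pre ++ [a]) b d post := by
  have hlt : ∀ p q r, p + 2 * q + 4 * r = a + 2 * b + 4 * d → a + b + d < p + q + r →
      wordRank (pre ++ p :: q :: r :: post) < n := by
    intro p q r h1 h2
    rw [← hn]
    refine ((WordLe.refl pre).append_lt ⟨by simp, ?_, ?_⟩).rank_lt
    · simp only [wordWeight]
      omega
    · simp only [List.sum_cons]
      omega
  have h := overlap_resolves (fun t => nf (pre ++ t.1 :: t.2.1 :: t.2.2 :: post)) hab hbd
    (fun p q r h1 h2 h3 => ih pre p q (r :: post) (hlt p q r h1 h2) h3)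
    (fun p q r h1 h2 h3 => by
      have h4 := ih (pre ++ [p]) q r post
      simp only [List.append_assoc, List.cons_append, List.nil_append] at h4
      rw [RelR, h4 (hlt p q r h1 h2) h3, nfStep]
      simp only [List.append_assoc, List.cons_append, List.nil_append])
  simpa [nfStep] using h

lemma nfStep_confluent {n : ℕ}
    (ih : ∀ pre a b post, wordRank (pre ++ a :: b :: post) < n → a ≤ b + 1 →
      nf (pre ++ a :: b :: post) = nfStep pre a b post)
    {pre post pre' post' : List ℕ} {a b a' b' : ℕ}
    (hn : wordRank (pre ++ a :: b :: post) = n)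
    (h : pre ++ a :: b :: post = pre' ++ a' :: b' :: post')
    (hab : a ≤ b + 1) (hab' : a' ≤ b' + 1) :
    nfStep pre a b post = nfStep pre' a' b' post' := by
  wlog hle : pre.length ≤ pre'.length generalizing pre post pre' post' a b a' b'
  · exact (this (h ▸ hn) h.symm hab' hab (by omega)).symm
  obtain ⟨t, rfl⟩ : ∃ t, pre' = pre ++ t := by
    rcases List.append_eq_append_iff.1 h with ⟨t, ht, -⟩ | ⟨t, ht, -⟩
    · exact ⟨t, ht⟩
    · rw [ht, List.length_append] at hle
      exact ⟨[], by rw [ht, List.eq_nil_of_length_eq_zero (by omega : t.length = 0)]; simp⟩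
  rw [List.append_assoc, List.append_cancel_left_eq] at h
  match t, h with
  | [], h =>
    simp only [List.nil_append, List.cons.injEq] at h
    obtain ⟨rfl, rfl, rfl⟩ := h
    simp
  | [x], h =>
    simp only [List.cons_append, List.nil_append, List.cons.injEq] at h
    obtain ⟨rfl, rfl, rfl⟩ := h
    exact nfStep_overlap ih pre post' hn hab hab'
  | x :: y :: t, h =>
    simp only [List.cons_append, List.cons.injEq] at h
    obtain ⟨rfl, rfl, rfl⟩ := h
    exact nfStep_disjoint ih pre t post' hn hab hab'

/-- Normal forms respect the Behrens relations. -/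
lemma nf_eq_nfStep (pre : List ℕ) {a b : ℕ} (post : List ℕ) (hab : a ≤ b + 1) :
    nf (pre ++ a :: b :: post) = nfStep pre a b post := by
  induction h : wordRank (pre ++ a :: b :: post) using Nat.strong_induction_on
    generalizing pre a b post with
  | _ n ih =>
    obtain ⟨pre', a', b', post', hu, hab', hnf⟩ :=
      exists_nf_eq_nfStep ((not_adm_iff _).2 ⟨pre, a, b, post, rfl, hab⟩)
    rw [hnf]
    exact (nfStep_confluent (fun p x y q hlt hxy => ih _ hlt p q hxy rfl) h hu hab hab').symm

/-! ### The Poincaré–Birkhoff–Witt basis -/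

lemma behrensRHS_eq {a b : ℕ} (hab : a ≤ b + 1) :
    behrensRHS a b =
      ∑ c ∈ Finset.range (a - 1), behrensCoeff a b c • (Q (a + 2 * b - 2 * c) * Q c) := by
  rw [behrensRHS]
  symm
  refine Finset.sum_subset_zero_on_sdiff (Finset.range_subset_range.2 (by omega)) ?_ ?_
  · intro c hc
    simp only [Finset.mem_sdiff, Finset.mem_range] at hc
    have h0 : behrensCoeff a b c = 0 := by
      rw [behrensCoeff]
      split_ifs with h
      · rw [Nat.choose_eq_zero_of_lt (by omega), Nat.cast_zero]
      · rfl
    simp [h0]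
  · intro c hc
    rw [Finset.mem_range] at hc
    rw [if_pos (by omega)]

/-- The class of a word in the Behrens algebra. -/
def qmon (u : List ℕ) : BehrensAlgebra := toBehrens (mon u)

lemma qmon_nil : qmon [] = 1 := by simp [qmon, mon]

lemma qmon_append (u v : List ℕ) : qmon (u ++ v) = qmon u * qmon v := by
  simp [qmon, mon]

lemma qmon_step (pre : List ℕ) {a b : ℕ} (post : List ℕ) (hab : a ≤ b + 1) :
    qmon (pre ++ a :: b :: post) = ∑ c ∈ Finset.range (a - 1),
      behrensCoeff a b c • qmon (pre ++ (a + 2 * b - 2 * c) :: c :: post) := by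
  have h2 : ∀ x y, qmon (pre ++ x :: y :: post) =
      qmon pre * toBehrens (Q x * Q y) * qmon post := by
    intro x y
    simp [qmon, mon, mul_assoc]
  have h1 : toBehrens (Q a * Q b) = toBehrens (behrensRHS a b) :=
    RingQuot.mkAlgHom_rel _ (BehrensRel.mk a b hab)
  rw [h2, h1, behrensRHS_eq hab, map_sum, Finset.mul_sum, Finset.sum_mul]
  refine Finset.sum_congr rfl fun c _ => ?_
  rw [map_smul, mul_smul_comm, smul_mul_assoc, h2]

/-- Left multiplication by a generator on normal forms. -/
def nfLeft (a : ℕ) : Module.End (ZMod 2) (List ℕ →₀ ZMod 2) :=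
  Finsupp.linearCombination (ZMod 2) fun u => nf (a :: u)

lemma nfLeft_single (a : ℕ) (u : List ℕ) : nfLeft a (Finsupp.single u 1) = nf (a :: u) := by
  simp [nfLeft]

lemma nfLeft_nf (a : ℕ) (u : List ℕ) : nfLeft a (nf u) = nf (a :: u) := by
  induction h : wordRank u using Nat.strong_induction_on generalizing u with
  | _ n ih =>
    by_cases hu : Adm u
    · rw [nf_of_adm hu, nfLeft_single]
    · obtain ⟨pre, x, y, post, rfl, hxy⟩ := (not_adm_iff u).1 hu
      have h1 := nf_eq_nfStep (a :: pre) post hxy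
      rw [List.cons_append] at h1
      rw [nf_eq_nfStep pre post hxy, h1, nfStep, nfStep, map_sum]
      refine Finset.sum_congr rfl fun c hc => ?_
      rw [map_smul, ih _ (h ▸ (wordLt_step pre post hxy (Finset.mem_range.1 hc)).rank_lt) _ rfl]
      rfl

/-- The representation of the Behrens algebra on normal forms. -/
def nfRep : BehrensAlgebra →ₐ[ZMod 2] Module.End (ZMod 2) (List ℕ →₀ ZMod 2) :=
  RingQuot.liftAlgHom (ZMod 2) ⟨FreeAlgebra.lift (ZMod 2) nfLeft, by
    intro x y h
    obtain ⟨a, b, hab⟩ := h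
    refine Finsupp.lhom_ext' fun u => LinearMap.ext_ring ?_
    have hQ : ∀ x y, FreeAlgebra.lift (ZMod 2) nfLeft (Q x * Q y) (Finsupp.single u 1) =
        nf (x :: y :: u) := by
      intro x y
      rw [map_mul, Q, Q, FreeAlgebra.lift_ι_apply, FreeAlgebra.lift_ι_apply, Module.End.mul_apply,
        nfLeft_single, nfLeft_nf]
    simp only [LinearMap.comp_apply, Finsupp.lsingle_apply]
    rw [behrensRHS_eq hab, hQ, map_sum, LinearMap.sum_apply]
    refine (nf_eq_nfStep [] u hab).trans (Finset.sum_congr rfl fun c _ => ?_)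
    rw [map_smul, LinearMap.smul_apply, hQ]
    rfl⟩

lemma nfRep_qmon (u : List ℕ) : nfRep (qmon u) (Finsupp.single [] 1) = nf u := by
  induction u with
  | nil =>
    rw [qmon_nil, map_one, nf_of_adm List.IsChain.nil]
    rfl
  | cons a u ih =>
    have h : nfRep (qmon [a]) = nfLeft a := by
      have h1 : qmon [a] = RingQuot.mkAlgHom (ZMod 2) BehrensRel (Q a) := by
        simp [qmon, mon, toBehrens]
      rw [h1, nfRep, RingQuot.liftAlgHom_mkAlgHom_apply, Q, FreeAlgebra.lift_ι_apply]
    rw [← List.singleton_append, qmon_append, map_mul, Module.End.mul_apply, ih, h, nfLeft_nf]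
    rfl

/-- The span of the classes of the admissible words satisfying a condition. -/
def admSpan (P : List ℕ → Prop) : Submodule (ZMod 2) BehrensAlgebra :=
  Submodule.span (ZMod 2) (qmon '' {v | Adm v ∧ P v})

lemma qmon_mem_admSpan (u : List ℕ) : qmon u ∈ admSpan fun v => WordLe v u := by
  induction h : wordRank u using Nat.strong_induction_on generalizing u with
  | _ n ih =>
    by_cases hu : Adm u
    · exact Submodule.subset_span ⟨u, ⟨hu, WordLe.refl u⟩, rfl⟩
    · obtain ⟨pre, x, y, post, rfl, hxy⟩ := (not_adm_iff u).1 hu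
      rw [qmon_step pre post hxy]
      refine sum_mem fun c hc => Submodule.smul_mem _ _ ?_
      have hlt := wordLt_step pre post hxy (Finset.mem_range.1 hc)
      refine Submodule.span_mono (Set.image_mono ?_) (ih _ (h ▸ hlt.rank_lt) _ rfl)
      exact fun v hv => ⟨hv.1, hv.2.trans hlt.le⟩

lemma qmon_mem_admSpan_lt {u : List ℕ} (hu : ¬ Adm u) :
    qmon u ∈ admSpan fun v => WordLt v u := by
  obtain ⟨pre, x, y, post, rfl, hxy⟩ := (not_adm_iff u).1 hu
  rw [qmon_step pre post hxy]
  refine sum_mem fun c hc => Submodule.smul_mem _ _ ?_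
  have hlt := wordLt_step pre post hxy (Finset.mem_range.1 hc)
  refine Submodule.span_mono (Set.image_mono ?_) (qmon_mem_admSpan _)
  exact fun v hv => ⟨hv.1, hv.2.trans_lt hlt⟩

lemma linearIndependent_qmon :
    LinearIndependent (ZMod 2) fun u : {u : List ℕ // Adm u} => qmon u := by
  let f : BehrensAlgebra →ₗ[ZMod 2] (List ℕ →₀ ZMod 2) :=
    (LinearMap.applyₗ (Finsupp.single [] 1)).comp nfRep.toLinearMap
  refine LinearIndependent.of_comp f ?_
  have h : (f ∘ fun u : {u : List ℕ // Adm u} => qmon u) =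
      (fun u : List ℕ => (Finsupp.single u 1 : List ℕ →₀ ZMod 2)) ∘ Subtype.val := by
    funext u
    exact (nfRep_qmon u).trans (nf_of_adm u.2)
  rw [h]
  exact (Finsupp.basisSingleOne (R := ZMod 2)).linearIndependent.comp _ Subtype.val_injective

/-- The nonempty admissible words. -/
def AdmWord : Type := {u : List ℕ // Adm u ∧ u ≠ []}

lemma aug_qmon {u : List ℕ} (hu : u ≠ []) : aug (qmon u) = 0 := by
  obtain ⟨a, u, rfl⟩ := List.exists_cons_of_ne_nil hu
  rw [← List.singleton_append, qmon_append, map_mul]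
  have h1 : qmon [a] = RingQuot.mkAlgHom (ZMod 2) BehrensRel (Q a) := by
    simp [qmon, mon, toBehrens]
  have h2 : aug (qmon [a]) = 0 := by
    rw [h1, aug, RingQuot.liftAlgHom_mkAlgHom_apply, Q, FreeAlgebra.lift_ι_apply]
  rw [h2, zero_mul]

/-- The element of the augmentation ideal given by a nonempty admissible word. -/
def admElt (u : AdmWord) : augIdeal := ⟨qmon u.1, aug_qmon u.2.2⟩

lemma span_qmon : Submodule.span (ZMod 2) (Set.range qmon) = ⊤ := by
  rw [eq_top_iff]
  rintro x -
  obtain ⟨y, rfl⟩ := RingQuot.mkAlgHom_surjective (ZMod 2) BehrensRel x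
  change toBehrens y ∈ _
  induction y using FreeAlgebra.induction with
  | grade0 r =>
    rw [AlgHom.commutes, Algebra.algebraMap_eq_smul_one, ← qmon_nil]
    exact Submodule.smul_mem _ _ (Submodule.subset_span ⟨_, rfl⟩)
  | grade1 a => exact Submodule.subset_span ⟨[a], by simp [qmon, mon, Q]⟩
  | mul x y hx hy =>
    rw [map_mul]
    have h := Submodule.mul_mem_mul hx hy
    rw [Submodule.span_mul_span] at h
    refine Submodule.span_mono ?_ h
    rintro _ ⟨_, ⟨u, rfl⟩, _, ⟨v, rfl⟩, rfl⟩
    exact ⟨u ++ v, qmon_append u v⟩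
  | add x y hx hy => rw [map_add]; exact add_mem hx hy

/-- The span of the elements of the augmentation ideal given by the words satisfying a
condition. -/
def admSpanI (P : List ℕ → Prop) : Submodule (ZMod 2) augIdeal :=
  Submodule.span (ZMod 2) (admElt '' {v | P v.1})

lemma mem_admSpanI {P : List ℕ → Prop} (hP : ¬ P []) {x : augIdeal}
    (hx : (x : BehrensAlgebra) ∈ admSpan P) : x ∈ admSpanI P := by
  have h : admSpan P ≤ (admSpanI P).map augIdeal.subtype := by
    refine Submodule.span_le.2 ?_
    rintro _ ⟨v, ⟨hv, hPv⟩, rfl⟩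
    exact ⟨admElt ⟨v, hv, by rintro rfl; exact hP hPv⟩, Submodule.subset_span ⟨_, hPv, rfl⟩, rfl⟩
  obtain ⟨y, hy, hyx⟩ := h hx
  rwa [← Subtype.ext hyx]

lemma mem_admSpanI_of_mem {x : augIdeal} : x ∈ admSpanI fun _ => True := by
  have h : (⊤ : Submodule (ZMod 2) BehrensAlgebra) ≤
      Submodule.span (ZMod 2) {1} ⊔ (admSpanI fun _ => True).map augIdeal.subtype := by
    rw [← span_qmon]
    refine Submodule.span_le.2 ?_
    rintro _ ⟨u, rfl⟩
    refine Submodule.span_le.2 ?_ (qmon_mem_admSpan u)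
    rintro _ ⟨v, ⟨hv, -⟩, rfl⟩
    by_cases h0 : v = []
    · rw [h0, qmon_nil]
      exact Submodule.mem_sup_left (Submodule.mem_span_singleton_self 1)
    · exact Submodule.mem_sup_right
        ⟨admElt ⟨v, hv, h0⟩, Submodule.subset_span ⟨_, trivial, rfl⟩, rfl⟩
  obtain ⟨y, hy, z, ⟨z', hz', rfl⟩, hyz⟩ :=
    Submodule.mem_sup.1 (h (Submodule.mem_top (x := (x : BehrensAlgebra))))
  obtain ⟨r, rfl⟩ := Submodule.mem_span_singleton.1 hy
  have hx : aug (x : BehrensAlgebra) = 0 := x.2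
  have hz : aug (z' : BehrensAlgebra) = 0 := z'.2
  have h1 := congrArg aug hyz
  rw [map_add, map_smul, map_one, hx, Submodule.subtype_apply, hz, add_zero, smul_eq_mul,
    mul_one] at h1
  rw [h1, zero_smul, zero_add] at hyz
  rwa [← Subtype.ext hyz]

/-- The basis of the augmentation ideal given by the nonempty admissible words. -/
def admBasis : Module.Basis AdmWord (ZMod 2) augIdeal :=
  Module.Basis.mk (v := admElt)
    (by
      refine LinearIndependent.of_comp augIdeal.subtype ?_
      exact linearIndependent_qmon.comp (fun u : AdmWord => ⟨u.1, u.2.1⟩)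
        fun u v h => Subtype.ext (Subtype.mk.inj h))
    (by
      intro x _
      have h := mem_admSpanI_of_mem (x := x)
      refine Submodule.span_mono ?_ h
      rintro _ ⟨u, -, rfl⟩
      exact ⟨u, rfl⟩)

lemma admBasis_apply (u : AdmWord) : admBasis u = admElt u := by
  rw [admBasis, Module.Basis.mk_apply]

lemma mem_admSpanI_of_mem_Rdeg {m : ℕ} {x : augIdeal} (hx : (x : BehrensAlgebra) ∈ Rdeg m) :
    x ∈ admSpanI fun u => u.length = m := by
  rcases Nat.eq_zero_or_pos m with rfl | hm
  · have h : Rdeg 0 ≤ Submodule.span (ZMod 2) {1} := by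
      refine Submodule.span_le.2 ?_
      rintro _ ⟨L, hL, rfl⟩
      rw [List.length_eq_zero_iff.1 hL]
      exact Submodule.mem_span_singleton.2 ⟨1, by rw [one_smul]; exact qmon_nil.symm⟩
    obtain ⟨r, hr⟩ := Submodule.mem_span_singleton.1 (h hx)
    have hx0 : aug (x : BehrensAlgebra) = 0 := x.2
    rw [← hr, map_smul, map_one, smul_eq_mul, mul_one] at hx0
    rw [hx0, zero_smul] at hr
    rw [show x = 0 from Subtype.ext hr.symm]
    exact zero_mem _
  · refine mem_admSpanI (by simpa using hm.ne) ?_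
    refine Submodule.span_le.2 ?_ hx
    rintro _ ⟨L, hL, rfl⟩
    refine Submodule.span_mono (Set.image_mono ?_) (qmon_mem_admSpan L)
    exact fun v hv => ⟨hv.1, hv.2.1.trans hL⟩

lemma admElt_mem_Rdeg (u : AdmWord) : (admElt u : BehrensAlgebra) ∈ Rdeg u.1.length :=
  Submodule.subset_span ⟨u.1, rfl, rfl⟩

lemma mulI_admElt_mem_lt {u v : AdmWord} (h : ¬ Adm (u.1 ++ v.1)) :
    mulI (admElt u) (admElt v) ∈ admSpanI fun w => WordLt w (u.1 ++ v.1) := by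
  refine mem_admSpanI (fun h => ?_) ?_
  · exact u.2.2 (List.append_eq_nil_iff.1 (List.length_eq_zero_iff.1 h.1.symm)).1
  · change qmon u.1 * qmon v.1 ∈ _
    rw [← qmon_append]
    exact qmon_mem_admSpan_lt h

lemma mulI_admElt {u v w : AdmWord} (h : w.1 = u.1 ++ v.1) :
    mulI (admElt u) (admElt v) = admElt w :=
  Subtype.ext (by change qmon u.1 * qmon v.1 = qmon w.1; rw [h, qmon_append])

/-! ### The bar complex in terms of admissible words -/

/-- The pure tensors in the bar complex. -/
def tm (r : ℕ) : augIdeal →ₗ[ZMod 2] C r →ₗ[ZMod 2] C (r + 1) :=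
  (TensorProduct.mk (ZMod 2) augIdeal (C r) :
    augIdeal →ₗ[ZMod 2] C r →ₗ[ZMod 2] augIdeal ⊗[ZMod 2] (C r))

/-- Multiplication of the first tensor factor by an element of the augmentation ideal. -/
def mulFirst (r : ℕ) (x : augIdeal) : C (r + 1) →ₗ[ZMod 2] C (r + 1) :=
  (LinearMap.rTensor (C r) (mulI x) :
    augIdeal ⊗[ZMod 2] (C r) →ₗ[ZMod 2] augIdeal ⊗[ZMod 2] (C r))

lemma mulFirst_tm (r : ℕ) (x y : augIdeal) (z : C r) :
    mulFirst r x (tm r y z) = tm r (mulI x y) z := rfl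

lemma bar_induction {r : ℕ} {P : C (r + 1) → Prop} (htm : ∀ x y, P (tm r x y))
    (hadd : ∀ x y, P x → P y → P (x + y)) (z : C (r + 1)) : P z := by
  refine TensorProduct.induction_on (motive := P) z ?_ htm hadd
  have h := htm 0 0
  rwa [map_zero] at h

lemma dBar_tm (r : ℕ) (x : augIdeal) (y : C (r + 1)) :
    dBar (r + 1) (tm (r + 1) x y) = tm r x (dBar r y) + mulFirst r x y := by
  induction y using bar_induction with
  | htm y z => rfl
  | hadd y z hy hz => simp only [map_add, hy, hz]; abel

lemma mulI_assoc (x y z : augIdeal) : mulI (mulI x y) z = mulI x (mulI y z) :=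
  Subtype.ext (mul_assoc (x : BehrensAlgebra) y z)

lemma bar_add_self {r : ℕ} (x : C r) : x + x = 0 := by
  rw [← two_smul (ZMod 2) x, show (2 : ZMod 2) = 0 from rfl, zero_smul]

lemma dBar_dBar (r : ℕ) (x : C (r + 2)) : dBar r (dBar (r + 1) x) = 0 := by
  induction r with
  | zero => rfl
  | succ r ih =>
    have hm : ∀ (x : augIdeal) (y : C (r + 2)), mulFirst r x (dBar (r + 1) y) +
        dBar (r + 1) (mulFirst (r + 1) x y) = 0 := by
      intro x y
      induction y using bar_induction with
      | htm y z =>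
        have h : mulFirst r x (mulFirst r y z) = mulFirst r (mulI x y) z := by
          induction z using bar_induction with
          | htm z t => rw [mulFirst_tm, mulFirst_tm, mulFirst_tm, mulI_assoc]
          | hadd z t hz ht => rw [map_add, map_add, map_add, hz, ht]
        rw [mulFirst_tm, dBar_tm, dBar_tm, map_add, mulFirst_tm, h, bar_add_self]
      | hadd y z hy hz =>
        rw [map_add, map_add, map_add, map_add, add_add_add_comm, hy, hz, add_zero]
    induction x using bar_induction with
    | htm x y => rw [dBar_tm, map_add, dBar_tm, ih, map_zero, zero_add, hm]
    | hadd x y hx hy => rw [map_add, map_add, hx, hy, add_zero]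

/-- The index set of the basis of the bar complex: tuples of nonempty admissible words. -/
def Ix : ℕ → Type
  | 0 => Unit
  | r + 1 => AdmWord × Ix r

/-- The concatenation of a tuple of words. -/
def flat : (r : ℕ) → Ix r → List ℕ
  | 0, _ => []
  | r + 1, p => p.1.1 ++ flat r p.2

/-- The basis element of the bar complex given by a tuple of words. -/
def barElt : (r : ℕ) → Ix r → C r
  | 0, _ => (1 : ZMod 2)
  | r + 1, p => tm r (admElt p.1) (barElt r p.2)

lemma flat_succ {r : ℕ} (u : AdmWord) (p : Ix r) : flat (r + 1) (u, p) = u.1 ++ flat r p := rfl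

lemma barElt_succ {r : ℕ} (u : AdmWord) (p : Ix r) :
    barElt (r + 1) (u, p) = tm r (admElt u) (barElt r p) := rfl

/-- The basis of the bar complex. -/
def barBasis : (r : ℕ) → Module.Basis (Ix r) (ZMod 2) (C r)
  | 0 => (Module.Basis.singleton Unit (ZMod 2) : Module.Basis Unit (ZMod 2) (ZMod 2))
  | r + 1 => (admBasis.tensorProduct (barBasis r) :
      Module.Basis (AdmWord × Ix r) (ZMod 2) (augIdeal ⊗[ZMod 2] (C r)))

lemma barBasis_apply (r : ℕ) (p : Ix r) : barBasis r p = barElt r p := by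
  induction r with
  | zero => exact Module.Basis.singleton_apply Unit (ZMod 2) p
  | succ r ih =>
    refine (Module.Basis.tensorProduct_apply' admBasis (barBasis r) p).trans ?_
    rw [admBasis_apply, ih]
    rfl

/-- The span of the basis elements of the bar complex whose concatenation satisfies a condition. -/
def barSpan (r : ℕ) (P : List ℕ → Prop) : Submodule (ZMod 2) (C r) :=
  Submodule.span (ZMod 2) (barElt r '' {p | P (flat r p)})

lemma barElt_mem {r : ℕ} {P : List ℕ → Prop} {p : Ix r} (h : P (flat r p)) :
    barElt r p ∈ barSpan r P :=
  Submodule.subset_span ⟨p, h, rfl⟩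

lemma barSpan_mono {r : ℕ} {P P' : List ℕ → Prop} (h : ∀ l, P l → P' l) :
    barSpan r P ≤ barSpan r P' :=
  Submodule.span_mono (Set.image_mono fun _ hp => h _ hp)

lemma map_mem_of_barSpan {r : ℕ} {M : Type*} [AddCommGroup M] [Module (ZMod 2) M]
    {P : List ℕ → Prop} {S : Submodule (ZMod 2) M} (f : C r →ₗ[ZMod 2] M)
    (h : ∀ p, P (flat r p) → f (barElt r p) ∈ S) {x : C r} (hx : x ∈ barSpan r P) : f x ∈ S := by
  have h' : barSpan r P ≤ S.comap f := by
    refine Submodule.span_le.2 ?_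
    rintro _ ⟨p, hp, rfl⟩
    exact h p hp
  exact h' hx

lemma tm_mem {r : ℕ} {P P' R : List ℕ → Prop} (h : ∀ u v, P u → P' v → R (u ++ v))
    {x : augIdeal} (hx : x ∈ admSpanI P) {y : C r} (hy : y ∈ barSpan r P') :
    tm r x y ∈ barSpan (r + 1) R := by
  have h' : admSpanI P ≤ (barSpan (r + 1) R).comap ((tm r).flip y) := by
    refine Submodule.span_le.2 ?_
    rintro _ ⟨u, hu, rfl⟩
    exact map_mem_of_barSpan (tm r (admElt u))
      (fun p hp => barElt_mem (r := r + 1) (p := (u, p)) (h _ _ hu hp)) hy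
  exact h' hx

lemma admElt_mem {P : List ℕ → Prop} {u : AdmWord} (h : P u.1) : admElt u ∈ admSpanI P :=
  Submodule.subset_span ⟨u, h, rfl⟩

lemma mulFirst_mem_lt {r : ℕ} {u : AdmWord} {p : Ix (r + 1)} (h : ¬ Adm (u.1 ++ p.1.1)) :
    mulFirst r (admElt u) (barElt (r + 1) p) ∈
      barSpan (r + 1) fun l => WordLt l (u.1 ++ flat (r + 1) p) := by
  obtain ⟨v, p⟩ := p
  refine tm_mem (fun a b ha (hb : b = flat r p) => ?_) (mulI_admElt_mem_lt h) (barElt_mem rfl)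
  rw [hb, flat_succ, ← List.append_assoc]
  exact ha.append_le (WordLe.refl _)

/-- `l` is `l'` or a term of a proper rewriting of `l'`. -/
def WordEqLt (l l' : List ℕ) : Prop := l = l' ∨ WordLt l l'

lemma WordEqLt.le {l l' : List ℕ} (h : WordEqLt l l') : WordLe l l' := by
  rcases h with rfl | h
  · exact WordLe.refl l
  · exact h.le

lemma mulFirst_mem (r : ℕ) (u : AdmWord) (p : Ix (r + 1)) :
    mulFirst r (admElt u) (barElt (r + 1) p) ∈
      barSpan (r + 1) fun l => WordEqLt l (u.1 ++ flat (r + 1) p) := by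
  obtain ⟨v, p⟩ := p
  by_cases h : Adm (u.1 ++ v.1)
  · let w : AdmWord := ⟨u.1 ++ v.1, h, by simp [u.2.2]⟩
    have h1 : mulFirst r (admElt u) (barElt (r + 1) (v, p)) = barElt (r + 1) (w, p) := by
      rw [barElt_succ, mulFirst_tm, mulI_admElt (w := w) rfl, barElt_succ]
    rw [h1]
    exact barElt_mem (Or.inl (by rw [flat_succ, flat_succ, List.append_assoc]))
  · exact barSpan_mono (fun _ => Or.inr) (mulFirst_mem_lt h)

lemma dBar_barElt_mem (r : ℕ) (p : Ix (r + 1)) :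
    dBar r (barElt (r + 1) p) ∈ barSpan r fun l => WordEqLt l (flat (r + 1) p) := by
  induction r with
  | zero => exact zero_mem _
  | succ r ih =>
    obtain ⟨u, p⟩ := p
    rw [barElt_succ, dBar_tm]
    refine add_mem (tm_mem (fun a b (ha : a = u.1) hb => ?_) (admElt_mem rfl) (ih p))
      (mulFirst_mem r u p)
    rw [ha, flat_succ]
    rcases hb with rfl | hb
    · exact Or.inl rfl
    · exact Or.inr ((WordLe.refl _).append_lt hb)

/-- The letter `a` may stand in front of the word `l`. -/
def Linked (a : ℕ) (l : List ℕ) : Prop := ∀ b ∈ l.head?, b + 1 < a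

lemma adm_cons_iff {a : ℕ} {l : List ℕ} (hl : Adm l) : Adm (a :: l) ↔ Linked a l := by
  rw [Adm, List.isChain_cons, Linked]
  exact and_iff_left hl

lemma linked_flat_iff {r : ℕ} (a : ℕ) (p : Ix (r + 1)) :
    Linked a (flat (r + 1) p) ↔ Adm ([a] ++ p.1.1) := by
  obtain ⟨⟨l, hl, hne⟩, p⟩ := p
  rw [List.singleton_append, adm_cons_iff hl]
  obtain ⟨b, l, rfl⟩ := List.exists_cons_of_ne_nil hne
  rfl

/-- The nonempty admissible word consisting of one letter. -/
def letter (a : ℕ) : AdmWord := ⟨[a], List.IsChain.singleton a, List.cons_ne_nil _ _⟩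

open Classical in
/-- The contracting homotopy on basis elements. -/
def htpyElt : (r : ℕ) → Ix r → C (r + 1)
  | 0, _ => 0
  | _ + 1, (⟨[], h⟩, _) => absurd rfl h.2
  | r + 1, (⟨[a], _⟩, p) => if Linked a (flat r p) then 0
    else tm (r + 1) (admElt (letter a)) (htpyElt r p)
  | r + 1, (⟨a :: b :: l, h⟩, p) => tm (r + 1) (admElt (letter a))
      (tm r (admElt ⟨b :: l, h.1.tail, List.cons_ne_nil _ _⟩) (barElt r p))

/-- The contracting homotopy. -/
def htpy (r : ℕ) : C r →ₗ[ZMod 2] C (r + 1) := (barBasis r).constr (ZMod 2) (htpyElt r)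

lemma htpy_barElt (r : ℕ) (p : Ix r) : htpy r (barElt r p) = htpyElt r p := by
  rw [htpy, ← barBasis_apply, Module.Basis.constr_basis]

lemma htpyElt_mem (r : ℕ) (p : Ix r) : htpyElt r p ∈ barSpan (r + 1) fun l => l = flat r p := by
  induction r with
  | zero => exact zero_mem _
  | succ r ih =>
    match p with
    | (⟨[], h⟩, _) => exact absurd rfl h.2
    | (⟨[a], _⟩, p) =>
      rw [htpyElt]
      split_ifs
      · exact zero_mem _
      · exact tm_mem (P := fun l => l = [a]) (by rintro u v rfl rfl; rfl) (admElt_mem rfl) (ih p)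
    | (⟨a :: b :: l, h⟩, p) =>
      exact barElt_mem (r := r + 2)
        (p := (letter a, (⟨b :: l, h.1.tail, List.cons_ne_nil _ _⟩, p))) (by simp [flat, letter])

lemma htpy_mem {r : ℕ} {P : List ℕ → Prop} {x : C r} (hx : x ∈ barSpan r P) :
    htpy r x ∈ barSpan (r + 1) P := by
  refine map_mem_of_barSpan _ (fun p hp => ?_) hx
  rw [htpy_barElt]
  refine barSpan_mono ?_ (htpyElt_mem r p)
  rintro _ rfl
  exact hp

lemma htpy_tm_long {r : ℕ} {a : ℕ} {u v : AdmWord} (h : u.1 = a :: v.1) (y : C r) :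
    htpy (r + 1) (tm r (admElt u) y) = tm (r + 1) (admElt (letter a)) (tm r (admElt v) y) := by
  obtain ⟨_, hu⟩ := u
  obtain ⟨l, hv⟩ := v
  obtain rfl : _ = a :: l := h
  obtain ⟨b, l, rfl⟩ := List.exists_cons_of_ne_nil hv.2
  have h1 : (htpy (r + 1)).comp (tm r (admElt ⟨a :: b :: l, hu⟩)) =
      (tm (r + 1) (admElt (letter a))).comp (tm r (admElt ⟨b :: l, hv⟩)) := by
    refine (barBasis r).ext fun p => ?_
    rw [barBasis_apply]
    exact htpy_barElt (r + 1) (⟨a :: b :: l, hu⟩, p)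
  exact LinearMap.congr_fun h1 y

lemma htpy_tm_linked {r : ℕ} {a : ℕ} {p : Ix r} (h : Linked a (flat r p)) :
    htpy (r + 1) (tm r (admElt (letter a)) (barElt r p)) = 0 :=
  (htpy_barElt (r + 1) (letter a, p)).trans (if_pos h)

lemma htpy_tm_not_linked {r : ℕ} {a : ℕ} {p : Ix r} (h : ¬ Linked a (flat r p)) :
    htpy (r + 1) (tm r (admElt (letter a)) (barElt r p)) =
      tm (r + 1) (admElt (letter a)) (htpy r (barElt r p)) := by
  rw [htpy_barElt]
  exact (htpy_barElt (r + 1) (letter a, p)).trans (if_neg h)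

lemma tm_letter_mem_lt {r : ℕ} (a : ℕ) {l : List ℕ} {y : C r}
    (hy : y ∈ barSpan r fun l' => WordLt l' l) :
    tm r (admElt (letter a)) y ∈ barSpan (r + 1) fun l' => WordLt l' (a :: l) := by
  refine tm_mem (P := fun l => l = [a]) ?_ (admElt_mem rfl) hy
  rintro u v rfl hv
  exact (WordLe.refl [a]).append_lt hv

/-- The homotopy formula for a long first word. -/
lemma htpy_formula_long (r : ℕ) {a : ℕ} {u v : AdmWord} (h : u.1 = a :: v.1) (p : Ix r) :
    dBar (r + 1) (htpy (r + 1) (barElt (r + 1) (u, p))) +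
      htpy r (dBar r (barElt (r + 1) (u, p))) - barElt (r + 1) (u, p) ∈
        barSpan (r + 1) fun l => WordLt l (flat (r + 1) (u, p)) := by
  have hmul : mulI (admElt (letter a)) (admElt v) = admElt u := mulI_admElt h
  rw [barElt_succ, htpy_tm_long h, dBar_tm, mulFirst_tm, hmul, add_right_comm, add_sub_cancel_right]
  cases r with
  | zero =>
    have h0 : ∀ x, dBar 0 x = 0 := fun _ => rfl
    rw [h0, h0, map_zero, map_zero, add_zero]
    exact zero_mem _
  | succ r =>
    rw [dBar_tm, dBar_tm, map_add, map_add, htpy_tm_long h, add_add_add_comm, bar_add_self,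
      zero_add]
    obtain ⟨v', p⟩ := p
    by_cases hA : Adm (u.1 ++ v'.1)
    · have hA' : Adm (v.1 ++ v'.1) := by
        rw [h] at hA
        exact hA.tail
      let w : AdmWord := ⟨u.1 ++ v'.1, hA, by simp [u.2.2]⟩
      let w' : AdmWord := ⟨v.1 ++ v'.1, hA', by simp [v.2.2]⟩
      rw [barElt_succ, mulFirst_tm, mulFirst_tm, mulI_admElt (w := w) rfl, mulI_admElt (w := w') rfl,
        htpy_tm_long (a := a) (v := w') (by simp [w, w', h]), bar_add_self]
      exact zero_mem _
    · have hA' : ¬ Adm (v.1 ++ v'.1) := by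
        intro hA'
        refine hA ?_
        rw [h, List.cons_append, adm_cons_iff hA']
        have hl := (adm_cons_iff v.2.1).1 (h ▸ u.2.1)
        obtain ⟨b, l, hbl⟩ := List.exists_cons_of_ne_nil v.2.2
        rw [hbl] at hl ⊢
        exact hl
      refine add_mem ?_ (htpy_mem (mulFirst_mem_lt hA))
      have h2 := tm_letter_mem_lt a (mulFirst_mem_lt (p := (v', p)) hA')
      rw [← List.cons_append, ← h] at h2
      exact h2

/-- The homotopy formula for a letter followed by a word with which it is admissible. -/
lemma htpy_formula_linked (r : ℕ) {a : ℕ} {p : Ix (r + 1)} (h : Linked a (flat (r + 1) p)) :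
    dBar (r + 2) (htpy (r + 2) (barElt (r + 2) (letter a, p))) +
      htpy (r + 1) (dBar (r + 1) (barElt (r + 2) (letter a, p))) - barElt (r + 2) (letter a, p) ∈
        barSpan (r + 2) fun l => WordLt l (flat (r + 2) (letter a, p)) := by
  have hA := (linked_flat_iff a p).1 h
  have h1 : htpy (r + 1) (mulFirst r (admElt (letter a)) (barElt (r + 1) p)) =
      barElt (r + 2) (letter a, p) := by
    obtain ⟨v, p⟩ := p
    let w : AdmWord := ⟨[a] ++ v.1, hA, by simp⟩
    rw [barElt_succ, mulFirst_tm, mulI_admElt (u := letter a) (w := w) rfl,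
      htpy_tm_long (a := a) (v := v) rfl]
    rfl
  have h2 : barElt (r + 2) (letter a, p) = tm (r + 1) (admElt (letter a)) (barElt (r + 1) p) := rfl
  rw [h2, htpy_tm_linked h, map_zero, zero_add, dBar_tm, map_add, h1, h2, add_sub_cancel_right]
  refine map_mem_of_barSpan ((htpy (r + 1)).comp (tm r (admElt (letter a)))) (fun q hq => ?_)
    (dBar_barElt_mem r p)
  rw [LinearMap.comp_apply]
  rcases hq with hq | hq
  · rw [htpy_tm_linked (by rwa [hq])]
    exact zero_mem _
  · exact htpy_mem (tm_letter_mem_lt a (barElt_mem hq))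

/-- The homotopy formula for a letter followed by a word with which it is not admissible. -/
lemma htpy_formula_not_linked (r : ℕ) {a : ℕ} {p : Ix (r + 1)}
    (h : ¬ Linked a (flat (r + 1) p))
    (ih : dBar (r + 1) (htpy (r + 1) (barElt (r + 1) p)) + htpy r (dBar r (barElt (r + 1) p)) -
      barElt (r + 1) p ∈ barSpan (r + 1) fun l => WordLt l (flat (r + 1) p)) :
    dBar (r + 2) (htpy (r + 2) (barElt (r + 2) (letter a, p))) +
      htpy (r + 1) (dBar (r + 1) (barElt (r + 2) (letter a, p))) - barElt (r + 2) (letter a, p) ∈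
        barSpan (r + 2) fun l => WordLt l (flat (r + 2) (letter a, p)) := by
  have h2 : barElt (r + 2) (letter a, p) = tm (r + 1) (admElt (letter a)) (barElt (r + 1) p) := rfl
  have h3 : flat (r + 2) (letter a, p) = a :: flat (r + 1) p := rfl
  rw [h2, h3, htpy_tm_not_linked h, dBar_tm, dBar_tm, map_add]
  have e1 := tm_letter_mem_lt a ih
  have e2 : mulFirst (r + 1) (admElt (letter a)) (htpy (r + 1) (barElt (r + 1) p)) ∈
      barSpan (r + 2) fun l => WordLt l (a :: flat (r + 1) p) := by
    refine map_mem_of_barSpan _ (fun q hq => ?_)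
      (htpy_mem (barElt_mem (P := (· = flat (r + 1) p)) rfl))
    rw [← hq] at h ⊢
    exact mulFirst_mem_lt (u := letter a) fun hA => h ((linked_flat_iff a q).2 hA)
  have e3 : htpy (r + 1) (mulFirst r (admElt (letter a)) (barElt (r + 1) p)) ∈
      barSpan (r + 2) fun l => WordLt l (a :: flat (r + 1) p) :=
    htpy_mem (mulFirst_mem_lt (u := letter a) fun hA => h ((linked_flat_iff a p).2 hA))
  have e4 : htpy (r + 1) (tm r (admElt (letter a)) (dBar r (barElt (r + 1) p))) -
      tm (r + 1) (admElt (letter a)) (htpy r (dBar r (barElt (r + 1) p))) ∈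
      barSpan (r + 2) fun l => WordLt l (a :: flat (r + 1) p) := by
    refine map_mem_of_barSpan ((htpy (r + 1)).comp (tm r (admElt (letter a))) -
      (tm (r + 1) (admElt (letter a))).comp (htpy r)) (fun q hq => ?_) (dBar_barElt_mem r p)
    rw [LinearMap.sub_apply, LinearMap.comp_apply, LinearMap.comp_apply]
    rcases hq with hq | hq
    · rw [htpy_tm_not_linked (by rwa [hq]), sub_self]
      exact zero_mem _
    · exact sub_mem (htpy_mem (tm_letter_mem_lt a (barElt_mem hq)))
        (tm_letter_mem_lt a (htpy_mem (barElt_mem hq)))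
  convert add_mem (add_mem e1 e2) (add_mem e3 e4) using 1
  rw [map_sub, map_add]
  abel

lemma htpy_formula (r : ℕ) (p : Ix (r + 1)) (hp : (flat (r + 1) p).length ≠ r + 1) :
    dBar (r + 1) (htpy (r + 1) (barElt (r + 1) p)) + htpy r (dBar r (barElt (r + 1) p)) -
      barElt (r + 1) p ∈ barSpan (r + 1) fun l => WordLt l (flat (r + 1) p) := by
  induction r with
  | zero =>
    match p with
    | (⟨[], h⟩, _) => exact absurd rfl h.2
    | (⟨[a], _⟩, p) => exact absurd rfl hp
    | (⟨a :: b :: l, h⟩, p) =>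
      exact htpy_formula_long 0 (v := ⟨b :: l, h.1.tail, List.cons_ne_nil _ _⟩) rfl p
  | succ r ih =>
    match p with
    | (⟨[], h⟩, _) => exact absurd rfl h.2
    | (⟨[a], _⟩, p) =>
      by_cases h : Linked a (flat (r + 1) p)
      · exact htpy_formula_linked r h
      · refine htpy_formula_not_linked r h (ih p fun hl => hp ?_)
        exact congrArg Nat.succ hl
    | (⟨a :: b :: l, h⟩, p) =>
      exact htpy_formula_long (r + 1) (v := ⟨b :: l, h.1.tail, List.cons_ne_nil _ _⟩) rfl p

lemma dBar_mem_barSpan_length {r w : ℕ} {x : C (r + 1)}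
    (hx : x ∈ barSpan (r + 1) fun l => l.length = w) :
    dBar r x ∈ barSpan r fun l => l.length = w := by
  refine map_mem_of_barSpan _ (fun p hp => ?_) hx
  exact barSpan_mono (fun l hl => hl.le.1.trans hp) (dBar_barElt_mem r p)

lemma exists_dBar_eq_of_rank {r w : ℕ} (hw : w ≠ r + 1) (n : ℕ) {x : C (r + 1)}
    (hx : x ∈ barSpan (r + 1) fun l => l.length = w ∧ wordRank l < n) (hd : dBar r x = 0) :
    ∃ y ∈ barSpan (r + 2) (fun l => l.length = w), dBar (r + 1) y = x := by
  induction n generalizing x with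
  | zero =>
    refine ⟨0, zero_mem _, ?_⟩
    have h0 : x ∈ (⊥ : Submodule (ZMod 2) (C (r + 1))) :=
      map_mem_of_barSpan LinearMap.id (fun p hp => absurd hp.2 (Nat.not_lt_zero _)) hx
    rw [(Submodule.mem_bot _).1 h0, map_zero]
  | succ n ih =>
    have h1 : dBar (r + 1) (htpy (r + 1) x) + htpy r (dBar r x) - x ∈
        barSpan (r + 1) fun l => l.length = w ∧ wordRank l < n := by
      refine map_mem_of_barSpan ((dBar (r + 1)).comp (htpy (r + 1)) + (htpy r).comp (dBar r) -
        LinearMap.id) (fun p hp => ?_) hx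
      refine barSpan_mono (fun l hl => ⟨hl.1.trans hp.1, ?_⟩)
        (htpy_formula r p (fun h => hw (hp.1.symm.trans h)))
      exact hl.rank_lt.trans_le (Nat.lt_succ_iff.1 hp.2)
    rw [hd, map_zero, add_zero] at h1
    obtain ⟨y, hy, hyx⟩ := ih h1 (by rw [map_sub, hd, dBar_dBar, sub_zero])
    refine ⟨htpy (r + 1) x - y, sub_mem (htpy_mem (barSpan_mono (fun l hl => hl.1) hx)) hy, ?_⟩
    rw [map_sub, hyx, sub_sub_cancel]

lemma exists_dBar_eq {r w : ℕ} (hw : w ≠ r + 1) {x : C (r + 1)}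
    (hx : x ∈ barSpan (r + 1) fun l => l.length = w) (hd : dBar r x = 0) :
    ∃ y ∈ barSpan (r + 2) (fun l => l.length = w), dBar (r + 1) y = x := by
  obtain ⟨n, hn⟩ : ∃ n, x ∈ barSpan (r + 1) fun l => l.length = w ∧ wordRank l < n := by
    clear hd
    induction hx using Submodule.span_induction with
    | mem x h =>
      obtain ⟨p, hp, rfl⟩ := h
      exact ⟨_, barElt_mem ⟨hp, Nat.lt_succ_self _⟩⟩
    | zero => exact ⟨0, zero_mem _⟩
    | add x y _ _ hx hy =>
      obtain ⟨n, hn⟩ := hx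
      obtain ⟨m, hm⟩ := hy
      exact ⟨max n m,
        add_mem (barSpan_mono (fun l hl => ⟨hl.1, hl.2.trans_le (le_max_left _ _)⟩) hn)
          (barSpan_mono (fun l hl => ⟨hl.1, hl.2.trans_le (le_max_right _ _)⟩) hm)⟩
    | smul c x _ hx =>
      obtain ⟨n, hn⟩ := hx
      exact ⟨n, Submodule.smul_mem _ _ hn⟩
  exact exists_dBar_eq_of_rank hw n hn hd

lemma wt_eq_barSpan (r w : ℕ) : Wt r w = barSpan r fun l => l.length = w := by
  induction r generalizing w with
  | zero =>
    rw [Wt]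
    split_ifs with h
    · refine (eq_top_iff.2 ?_).symm
      rw [← (barBasis 0).span_eq]
      refine Submodule.span_le.2 ?_
      rintro _ ⟨p, rfl⟩
      rw [barBasis_apply]
      exact barElt_mem h.symm
    · refine (eq_bot_iff.2 (Submodule.span_le.2 ?_)).symm
      rintro _ ⟨p, hp, rfl⟩
      exact absurd hp.symm h
  | succ r ih =>
    refine le_antisymm (Submodule.span_le.2 ?_) (Submodule.span_le.2 ?_)
    · rintro _ ⟨m, m', x, y, hw, hx, hy, rfl⟩
      rw [ih] at hy
      refine tm_mem (fun u v hu hv => ?_) (mem_admSpanI_of_mem_Rdeg hx) hy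
      rw [List.length_append, hu, hv, hw]
    · rintro _ ⟨⟨u, p⟩, hp, rfl⟩
      refine Submodule.subset_span
        ⟨_, (flat r p).length, _, _, ?_, admElt_mem_Rdeg u, ?_, barElt_succ u p⟩
      · rw [← hp]
        exact List.length_append.symm
      · rw [ih]
        exact barElt_mem rfl

lemma isInternal_span_fiber {ι R M : Type*} [DivisionRing R] [AddCommGroup M] [Module R M]
    (b : Module.Basis ι R M) (f : ι → ℕ) :
    DirectSum.IsInternal fun w => Submodule.span R (b '' {i | f i = w}) := by
  rw [DirectSum.isInternal_submodule_iff_iSupIndep_and_iSup_eq_top]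
  constructor
  · intro w
    have h : Disjoint (Submodule.span R (b '' {i | f i = w}))
        (Submodule.span R (b '' {i | f i ≠ w})) := by
      refine b.linearIndependent.disjoint_span_image ?_
      rw [Set.disjoint_left]
      exact fun i hi hi' => hi' hi
    refine h.mono_right (iSup₂_le fun j hj => Submodule.span_mono (Set.image_mono ?_))
    rintro i rfl
    exact hj
  · rw [eq_top_iff, ← b.span_eq]
    refine Submodule.span_le.2 ?_
    rintro _ ⟨i, rfl⟩
    exact Submodule.mem_iSup_of_mem (f i) (Submodule.subset_span ⟨i, rfl, rfl⟩)

lemma isInternal_wt (r : ℕ) : DirectSum.IsInternal fun w : ℕ => Wt r w := by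
  have h := isInternal_span_fiber (barBasis r) fun p => (flat r p).length
  convert h using 2 with w
  rw [wt_eq_barSpan, barSpan]
  congr 1
  exact Set.image_congr fun p _ => (barBasis_apply r p).symm

/-- Koszulity of the Behrens algebra. For the reduced bar complex
`C` of the lower-indexed Behrens algebra, graded by total monomial length:
* `C` is a chain complex (`d ∘ d = 0`);
* each total-length-`w` homogeneous part is a subcomplex;
* in each simplicial degree `r`, `C r` is the internal direct sum of its
  homogeneous parts;
* the `r`-th homology of the weight-`w` subcomplex vanishes whenever `w ≠ r`
  (stated as: every weight-`w` cycle is the boundary of a weight-`w` element;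
  in degree `0` there is no cycle condition).
In other words, `Tor_r(F₂, F₂)` over the Behrens algebra is concentrated in
length weight `r`, i.e. the Behrens algebra is Koszul. -/
theorem behrensAlgebra_koszul :
    -- `C` is a chain complex
    (∀ r : ℕ, (dBar r).comp (dBar (r + 1)) = 0) ∧
    -- each `C r` is the internal direct sum of its homogeneous parts
    (∀ r : ℕ, DirectSum.IsInternal (fun w : ℕ => Wt r w)) ∧
    -- each homogeneous part is a subcomplex
    (∀ (r w : ℕ) (x : C (r + 1)), x ∈ Wt (r + 1) w → dBar r x ∈ Wt r w) ∧
    -- homology vanishes away from `w = r`: degree 0 case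
    (∀ w : ℕ, w ≠ 0 → ∀ x : C 0, x ∈ Wt 0 w →
      ∃ y : C 1, y ∈ Wt 1 w ∧ dBar 0 y = x) ∧
    -- homology vanishes away from `w = r`: positive degree case
    (∀ (r w : ℕ), w ≠ r + 1 → ∀ x : C (r + 1), x ∈ Wt (r + 1) w → dBar r x = 0 →
      ∃ y : C (r + 2), y ∈ Wt (r + 2) w ∧ dBar (r + 1) y = x) := by
  refine ⟨fun r => LinearMap.ext (dBar_dBar r), isInternal_wt, ?_, ?_, ?_⟩
  · intro r w x hx
    rw [wt_eq_barSpan] at hx ⊢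
    exact dBar_mem_barSpan_length hx
  · intro w hw x hx
    rw [Wt, if_neg hw, Submodule.mem_bot] at hx
    exact ⟨0, zero_mem _, by rw [map_zero, hx]⟩
  · intro r w hw x hx hd
    rw [wt_eq_barSpan] at hx
    obtain ⟨y, hy, hyx⟩ := exists_dBar_eq hw hx hd
    exact ⟨y, by rwa [wt_eq_barSpan], hyx⟩

end
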